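/- arXiv:1601.03521 — 9 statements merged into one kernel-verified Lean document; each statement's English description precedes it below -/
import Mathlib

section
/- Let A be a symmetric n×n real matrix that is Robinsonian and let σ be an SFS ordering of A. If x <_σ y <_σ z and there exists a Robinson ordering π of A with x <_π z <_π y, then A_{uy} = A_{uz} for every vertex u with u ≤_σ x. -/
/-- `π` is a Robinson ordering of the symmetric matrix `A`: entries are monotone
nondecreasing towards the diagonal. Here `π x` is the position of vertex `x`. -/
def IsRobinsonOrdering {n : ℕ} (A : Matrix (Fin n) (Fin n) ℝ)
    (π : Equiv.Perm (Fin n)) : Prop :=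
  ∀ x y z : Fin n, π x < π y → π y < π z → A x z ≤ min (A x y) (A y z)

/-- `A` is Robinsonian: it admits a Robinson ordering. -/
def IsRobinsonian {n : ℕ} (A : Matrix (Fin n) (Fin n) ℝ) : Prop :=
  ∃ π : Equiv.Perm (Fin n), IsRobinsonOrdering A π

/-- There is a path from `x` to `z` avoiding `y`: a sequence `x = v 0, v 1, ..., v k = z`
with `A (v i) (v (i+1)) > min (A y (v i)) (A y (v (i+1)))` for all `i < k`. -/
def PathAvoiding {n : ℕ} (A : Matrix (Fin n) (Fin n) ℝ) (x y z : Fin n) : Prop :=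
  ∃ (k : ℕ) (v : ℕ → Fin n), v 0 = x ∧ v k = z ∧
    ∀ i < k, min (A y (v i)) (A y (v (i + 1))) < A (v i) (v (i + 1))

/-- `z` is valid: for no pair of distinct vertices `u, v ≠ z` there exist both a path
from `u` to `z` avoiding `v` and a path from `v` to `z` avoiding `u`. -/
def IsValid {n : ℕ} (A : Matrix (Fin n) (Fin n) ℝ) (z : Fin n) : Prop :=
  ∀ u v : Fin n, u ≠ v → u ≠ z → v ≠ z →
    ¬ (PathAvoiding A u v z ∧ PathAvoiding A v u z)

/-- `a` is the first element of the linear order `π`. -/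
def IsFirstOf {n : ℕ} (π : Equiv.Perm (Fin n)) (a : Fin n) : Prop :=
  ∀ y : Fin n, π a ≤ π y

/-- `a` is the last element of the linear order `π`. -/
def IsLastOf {n : ℕ} (π : Equiv.Perm (Fin n)) (a : Fin n) : Prop :=
  ∀ y : Fin n, π y ≤ π a

/-- `a` is an anchor of `A`: some Robinson ordering of `A` ends with `a`. -/
def IsAnchor {n : ℕ} (A : Matrix (Fin n) (Fin n) ℝ) (a : Fin n) : Prop :=
  ∃ π : Equiv.Perm (Fin n), IsRobinsonOrdering A π ∧ IsLastOf π a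

/-- `a, b` are opposite anchors of `A`: some Robinson ordering starts with `a` and
ends with `b`. -/
def OppositeAnchors {n : ℕ} (A : Matrix (Fin n) (Fin n) ℝ) (a b : Fin n) : Prop :=
  ∃ π : Equiv.Perm (Fin n), IsRobinsonOrdering A π ∧ IsFirstOf π a ∧ IsLastOf π b

/-- `σ` is an SFS ordering of `A` (3-point characterization): whenever
`x <_σ y <_σ z` and `A x z > A x y`, some `u <_σ x` has `A u y > A u z`. -/
def IsSFSOrdering {n : ℕ} (A : Matrix (Fin n) (Fin n) ℝ)
    (σ : Equiv.Perm (Fin n)) : Prop :=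
  ∀ x y z : Fin n, σ x < σ y → σ y < σ z → A x y < A x z →
    ∃ u : Fin n, σ u < σ x ∧ A u z < A u y

/-- `σ` is an SFS₊ ordering of `A` with respect to `τ`: it is an SFS ordering and
ties are broken according to `τ` (whenever `y <_σ z` are tied, `z <_τ y`). -/
def IsSFSPlus {n : ℕ} (A : Matrix (Fin n) (Fin n) ℝ)
    (τ σ : Equiv.Perm (Fin n)) : Prop :=
  IsSFSOrdering A σ ∧
    ∀ y z : Fin n, σ y < σ z → (∀ u : Fin n, σ u < σ y → A u y = A u z) → τ z < τ y

/-- `σ` is a good SFS ordering of `A`: it is an SFS ordering whose first element is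
the last element of some SFS ordering of `A`. -/
def IsGoodSFS {n : ℕ} (A : Matrix (Fin n) (Fin n) ℝ)
    (σ : Equiv.Perm (Fin n)) : Prop :=
  IsSFSOrdering A σ ∧
    ∃ b : Fin n, IsFirstOf σ b ∧ ∃ τ : Equiv.Perm (Fin n), IsSFSOrdering A τ ∧ IsLastOf τ b

/-- The union `L_0 ∪ L_1 ∪ ... ∪ L_i` of the similarity layers of `A` rooted at `a`. -/
def simLayerUnion {n : ℕ} (A : Matrix (Fin n) (Fin n) ℝ) (a : Fin n) : ℕ → Set (Fin n)
  | 0 => {a}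
  | i + 1 => simLayerUnion A a i ∪
      {y | y ∉ simLayerUnion A a i ∧
        ∀ x ∈ simLayerUnion A a i, ∀ z ∉ simLayerUnion A a i, A x z ≤ A x y}

/-- The `i`th similarity layer `L_i` of `A` rooted at `a`: `L_0 = {a}` and
`L_{i+1} = {y ∉ L_0 ∪ ... ∪ L_i : A x y ≥ A x z for all x ∈ L_0 ∪ ... ∪ L_i and
z ∉ L_0 ∪ ... ∪ L_i}`. -/
def simLayer {n : ℕ} (A : Matrix (Fin n) (Fin n) ℝ) (a : Fin n) : ℕ → Set (Fin n)
  | 0 => {a}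
  | i + 1 => {y | y ∉ simLayerUnion A a i ∧
      ∀ x ∈ simLayerUnion A a i, ∀ z ∉ simLayerUnion A a i, A x z ≤ A x y}

theorem opp_le {n : ℕ} (A : Matrix (Fin n) (Fin n) ℝ) (hA : A.IsSymm)
    (π : Equiv.Perm (Fin n)) (hπ : IsRobinsonOrdering A π) (z a b : Fin n)
    (h : (π a < π z ∧ π z < π b) ∨ (π b < π z ∧ π z < π a)) : A a b ≤ A a z := by
  rcases h with ⟨h1, h2⟩ | ⟨h1, h2⟩
  · exact (hπ a z b h1 h2).trans (min_le_left _ _)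
  · have := (hπ b z a h1 h2).trans (min_le_right _ _)
    rwa [hA.apply a b, hA.apply a z] at this

theorem exists_first {n : ℕ} (σ : Equiv.Perm (Fin n)) (P : Fin n → Prop) (h : ∃ u, P u) :
    ∃ u, P u ∧ ∀ w, σ w < σ u → ¬ P w := by
  obtain ⟨u, hu, hm⟩ := WellFounded.has_min (measure (fun w => (σ w : ℕ))).wf {u | P u} h
  exact ⟨u, hu, fun w hw hp => hm w hp hw⟩

theorem descent {n : ℕ} (A : Matrix (Fin n) (Fin n) ℝ) (hA : A.IsSymm)
    (σ : Equiv.Perm (Fin n)) (hσ : IsSFSOrdering A σ)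
    (π : Equiv.Perm (Fin n)) (hπ : IsRobinsonOrdering A π) (z : Fin n) :
    ∀ (m : ℕ) (a b c : Fin n), (σ a : ℕ) = m → σ a < σ b → σ b < σ c → σ c < σ z →
      ((π a < π z ∧ π z < π b ∧ π c < π z) ∨ (π b < π z ∧ π z < π a ∧ π z < π c)) →
      A a z < A a c → (∀ w, σ w < σ a → A w c = A w z) → False := by
  intro m
  induction m using Nat.strong_induction_on with
  | _ m ih =>
    intro a b c hm hab hbc hcz hs hac ht
    have h1 : A a b ≤ A a z := opp_le A hA π hπ z a b (by tauto)
    obtain ⟨d, ⟨hda, hd⟩, hmin⟩ := exists_first σ (fun d => σ d < σ a ∧ A d c < A d b)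
      (hσ a b c hab hbc (h1.trans_lt hac))
    have hdc := ht d hda
    have hnopp : ¬ ((π d < π z ∧ π z < π b) ∨ (π b < π z ∧ π z < π d)) := fun h => by
      have := opp_le A hA π hπ z d b h
      linarith
    have hdz : π d ≠ π z := fun h => by
      have := π.injective h
      subst this
      exact absurd hcz (not_lt.mpr ((hda.trans hab).trans hbc).le)
    refine ih (σ d) (by omega) d a b rfl hda hab (hbc.trans hcz) ?_ (by linarith) ?_
    · rcases lt_or_gt_of_ne hdz with h | h <;> tauto
    · intro w hw
      have hwa := hw.trans hda
      rw [← ht w hwa]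
      refine le_antisymm (not_lt.mp fun h => hmin w hw ⟨hwa, h⟩) (not_lt.mp fun h => ?_)
      obtain ⟨v, hv, hv2⟩ := hσ w b c (hwa.trans hab) hbc h
      exact hmin v (hv.trans hw) ⟨hv.trans hwa, hv2⟩

/-- If `σ` is an SFS ordering of a symmetric Robinsonian matrix `A`,
`x <_σ y <_σ z`, and some Robinson ordering `π` has `x <_π z <_π y`, then
`A u y = A u z` for every `u ≤_σ x`. -/
theorem stmt_4 {n : ℕ} (A : Matrix (Fin n) (Fin n) ℝ) (hA : A.IsSymm)
    (σ : Equiv.Perm (Fin n)) (hσ : IsSFSOrdering A σ)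
    (x y z : Fin n) (hσ1 : σ x < σ y) (hσ2 : σ y < σ z)
    (π : Equiv.Perm (Fin n)) (hπ : IsRobinsonOrdering A π)
    (hπ1 : π x < π z) (hπ2 : π z < π y) :
    ∀ u : Fin n, σ u ≤ σ x → A u y = A u z := by
  by_contra hcon
  push Not at hcon
  obtain ⟨u, ⟨hux, hne⟩, hmin⟩ := exists_first σ (fun u => σ u ≤ σ x ∧ A u y ≠ A u z) hcon
  have ht : ∀ w, σ w < σ u → A w y = A w z := fun w hw => by
    by_contra h
    exact hmin w hw ⟨hw.le.trans hux, h⟩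
  have hlt : A u z < A u y := by
    rcases lt_or_gt_of_ne hne with h | h
    · obtain ⟨v, hv, hv2⟩ := hσ u y z (hux.trans_lt hσ1) hσ2 h
      exact absurd (ht v hv) hv2.ne'
    · exact h
  have huz : π z < π u := by
    rcases lt_trichotomy (π z) (π u) with h | h | h
    · exact h
    · have := π.injective h
      subst this
      exact absurd hux (not_le.mpr (hσ1.trans hσ2))
    · exact absurd (opp_le A hA π hπ z u y (Or.inl ⟨h, hπ2⟩)) (not_le.mpr hlt)
  have hux' : σ u < σ x := by
    refine lt_of_le_of_ne hux fun h => ?_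
    have := σ.injective h
    subst this
    exact absurd huz hπ1.le.not_gt
  exact descent A hA σ hσ π hπ z _ u x y rfl hux' hσ1 hσ2 (Or.inr ⟨hπ1, huz, hπ2⟩) hlt ht
end

section
/- Let A be a symmetric n×n real matrix that is Robinsonian, let σ be an SFS ordering of A, and let x, y, z be distinct vertices with x <_σ y <_σ z. Then: (i) A_{xy} ≥ min(A_{xz}, A_{yz}); (ii) if moreover x <_π z <_π y for some Robinson ordering π of A, then A_{xz} ≤ min(A_{xy}, A_{yz}). -/
theorem aux_min {n : ℕ} (A : Matrix (Fin n) (Fin n) ℝ)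
    (σ : Equiv.Perm (Fin n)) (hσ : IsSFSOrdering A σ) :
    ∀ (k : ℕ) (p q r : Fin n), (σ p).val = k → σ p < σ q → σ q < σ r → A p q < A p r →
      ∃ w, σ w < σ p ∧ A w r < A w q ∧ ∀ s, σ s < σ w → A s q = A s r := by
  intro k p q r _ h1 h2 h3
  obtain ⟨u, hu, hu2⟩ := hσ p q r h1 h2 h3
  have key : ∀ (k : ℕ) (u : Fin n), (σ u).val = k → σ u < σ p → A u q ≠ A u r →
      ∃ w, σ w < σ p ∧ A w r < A w q ∧ ∀ s, σ s < σ w → A s q = A s r := by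
    intro k
    induction k using Nat.strong_induction_on with
    | _ k ih =>
      intro u hk hup hne
      by_cases hall : ∀ s, σ s < σ u → A s q = A s r
      · rcases lt_or_gt_of_ne hne with h | h
        · obtain ⟨s, hs, hs2⟩ := hσ u q r (hup.trans h1) h2 h
          exact absurd (hall s hs) (ne_of_gt hs2)
        · exact ⟨u, hup, h, hall⟩
      · push Not at hall
        obtain ⟨s, hs, hs2⟩ := hall
        exact ih _ (by rw [← hk]; exact hs) s rfl (hs.trans hup) hs2
  exact key _ u rfl hu hu2.ne'

theorem aux_zigzag {n : ℕ} (A : Matrix (Fin n) (Fin n) ℝ) (hA : ∀ i j, A i j = A j i)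
    (σ : Equiv.Perm (Fin n)) (hσ : IsSFSOrdering A σ) (z : Fin n) :
    ∀ (k : ℕ) (f : Fin n → ℤ),
      (∀ x y z : Fin n, f x < f y → f y < f z → A x z ≤ A x y ∧ A x z ≤ A y z) →
      Function.Injective f →
      ∀ x y p q r : Fin n, (σ p).val = k → σ p < σ q → σ q < σ r → A p q < A p r →
      f x < f p → f p < f z → f z < f q → f q < f y →
      (∀ s, σ s < σ p → A s r = A s z ∧ A s x = A s z ∧ A s y = A s z) →
      σ p < σ x → σ p < σ y → σ p < σ z → False := by
  intro k
  induction k using Nat.strong_induction_on with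
  | _ k ih =>
    intro f hf hinj x y p q r hk h1 h2 h3 hxp hpz hzq hqy hall hpx' hpy' hpz'
    obtain ⟨w, hw, hw2, hw3⟩ := aux_min A σ hσ _ p q r rfl h1 h2 h3
    obtain ⟨e1, e2, e3⟩ := hall w hw
    have hwq : w ≠ q := by rintro rfl; exact absurd (hw.trans h1) (lt_irrefl _)
    have hzw : f z < f w := by
      rcases lt_trichotomy (f w) (f z) with h | h | h
      · have := (hf w z q h hzq).1; linarith
      · have := hinj h; subst this; exact absurd (hw.trans hpz') (lt_irrefl _)
      · exact h
    have hwy : f w < f y := by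
      rcases lt_trichotomy (f w) (f y) with h | h | h
      · exact h
      · have := hinj h; subst this; exact absurd (hw.trans hpy') (lt_irrefl _)
      · have := (hf q y w (by omega) (by omega))
        linarith [hA w q, hA w y]
    have a1 := hf p z w hpz hzw
    have a2 := hf x p w hxp (by omega)
    have b1 := hA p w
    have b2 := hA x w
    have b3 := hA z w
    refine ih _ (by rw [← hk]; exact hw) (fun i => - f i) ?_ ?_ y x w p q rfl hw h1
      (by linarith) (by simpa) (by simpa) (by simpa) (by simpa) ?_
      (hw.trans hpy') (hw.trans hpx') (hw.trans hpz')
    · intro a b c hab hbc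
      simp only [neg_lt_neg_iff] at hab hbc
      have := hf c b a hbc hab
      rw [hA a c, hA a b, hA b c]; exact this.symm
    · intro a b hab; exact hinj (by simpa using hab)
    · intro s hs
      obtain ⟨g1, g2, g3⟩ := hall s (hs.trans hw)
      exact ⟨(hw3 s hs).trans g1, g3, g2⟩

theorem aux_main {n : ℕ} (A : Matrix (Fin n) (Fin n) ℝ) (hA : ∀ i j, A i j = A j i)
    (σ : Equiv.Perm (Fin n)) (hσ : IsSFSOrdering A σ) :
    ∀ (k : ℕ) (f : Fin n → ℤ),
      (∀ x y z : Fin n, f x < f y → f y < f z → A x z ≤ A x y ∧ A x z ≤ A y z) →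
      Function.Injective f →
      ∀ x y z : Fin n, (σ x).val = k → σ x < σ y → σ y < σ z →
      f x < f z → f z < f y → A x z ≤ A x y := by
  intro k
  induction k using Nat.strong_induction_on with
  | _ k ih =>
    intro f hf hinj x y z hk h1 h2 hxz hzy
    by_contra hc
    push Not at hc
    obtain ⟨u, hu, hu2, hu3⟩ := aux_min A σ hσ _ x y z rfl h1 h2 hc
    have ne : ∀ a b : Fin n, σ a < σ b → f a ≠ f b := by
      intro a b hab h
      have := hinj h; subst this; exact lt_irrefl _ hab
    have hf' : ∀ x y z : Fin n, -f x < -f y → -f y < -f z → A x z ≤ A x y ∧ A x z ≤ A y z := by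
      intro a b c hab hbc
      simp only [neg_lt_neg_iff] at hab hbc
      have := hf c b a hbc hab
      rw [hA a c, hA a b, hA b c]; exact this.symm
    have hinj' : Function.Injective (fun i => - f i) := by
      intro a b hab; exact hinj (by simpa using hab)
    have n1 := ne u y (hu.trans h1)
    have n2 := ne u z ((hu.trans h1).trans h2)
    have hzu : f z < f u := by
      by_contra h
      have := hf u z y (by omega) hzy
      linarith
    have r1 := hf x z u hxz hzu
    have b1 := hA x u
    have b2 := hA z u
    have huy : f u < f y := by
      by_contra h
      have := ih _ (by rw [← hk]; exact hu) (fun i => - f i) hf' hinj' u x y rfl hu h1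
        (by simp only [neg_lt_neg_iff]; omega) (by simp only [neg_lt_neg_iff]; omega)
      linarith
    obtain ⟨v, hv, hv2, hv3⟩ := aux_min A σ hσ _ u x y rfl hu h1 (by linarith)
    have e := hu3 v hv
    have n3 := ne v x (hv.trans hu)
    have n4 := ne v z (((hv.trans hu).trans h1).trans h2)
    have hvz : f v < f z := by
      by_contra h
      have := hf x z v hxz (by omega)
      linarith [hA x v, hA z v]
    have r2 := hf v z u hvz hzu
    have r3 := hf v u y (by omega) huy
    have hxv : f x < f v := by
      by_contra h
      have := ih _ (by rw [← hk]; exact hv.trans hu) f hf hinj v u x rfl hv hu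
        (by omega) (by omega)
      linarith
    refine aux_zigzag A hA σ hσ z _ f hf hinj x y v u x rfl hv hu (by linarith)
      hxv hvz hzu huy ?_
      (hv.trans hu) ((hv.trans hu).trans h1) (((hv.trans hu).trans h1).trans h2)
    intro s hs
    have g1 := hv3 s hs
    have g2 := hu3 s (hs.trans hv)
    exact ⟨g1.trans g2, g1.trans g2, g2⟩

/-- If `σ` is an SFS ordering of a symmetric Robinsonian matrix `A` and
`x <_σ y <_σ z`, then (i) `A x y ≥ min (A x z) (A y z)`, and (ii) if moreover
`x <_π z <_π y` for some Robinson ordering `π`, then `A x z ≤ min (A x y) (A y z)`. -/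
theorem stmt_5 {n : ℕ} (A : Matrix (Fin n) (Fin n) ℝ) (hA : A.IsSymm)
    (hRob : IsRobinsonian A)
    (σ : Equiv.Perm (Fin n)) (hσ : IsSFSOrdering A σ)
    (x y z : Fin n) (hσ1 : σ x < σ y) (hσ2 : σ y < σ z) :
    min (A x z) (A y z) ≤ A x y ∧
      (∀ π : Equiv.Perm (Fin n), IsRobinsonOrdering A π → π x < π z → π z < π y →
        A x z ≤ min (A x y) (A y z)) := by
  have hs : ∀ i j, A i j = A j i := fun i j => (hA.apply j i)
  have conv : ∀ π : Equiv.Perm (Fin n), IsRobinsonOrdering A π →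
      ∀ x y z : Fin n, ((π x).val : ℤ) < (π y).val → ((π y).val : ℤ) < (π z).val →
        A x z ≤ A x y ∧ A x z ≤ A y z := by
    intro π hπ a b c h1 h2
    exact le_min_iff.1 (hπ a b c (Fin.lt_def.2 (by exact_mod_cast h1))
      (Fin.lt_def.2 (by exact_mod_cast h2)))
  have inj : ∀ π : Equiv.Perm (Fin n), Function.Injective (fun i => ((π i).val : ℤ)) := by
    intro π a b h
    have h' : ((π a).val : ℤ) = (π b).val := h
    exact π.injective (Fin.ext (by exact_mod_cast h'))
  constructor
  · obtain ⟨π, hπ⟩ := hRob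
    have hf := conv π hπ
    have hi := inj π
    have hf' : ∀ x y z : Fin n, -((π x).val : ℤ) < -((π y).val : ℤ) →
        -((π y).val : ℤ) < -((π z).val : ℤ) → A x z ≤ A x y ∧ A x z ≤ A y z := by
      intro a b c hab hbc
      have := hf c b a (by omega) (by omega)
      rw [hs a c, hs a b, hs b c]; exact this.symm
    have hi' : Function.Injective (fun i => - ((π i).val : ℤ)) := by
      intro a b hab; exact hi (by simpa using hab)
    have nxy : ((π x).val : ℤ) ≠ (π y).val := fun h => by
      have := hi h; subst this; exact lt_irrefl _ hσ1
    have nyz : ((π y).val : ℤ) ≠ (π z).val := fun h => by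
      have := hi h; subst this; exact lt_irrefl _ hσ2
    have nxz : ((π x).val : ℤ) ≠ (π z).val := fun h => by
      have := hi h; subst this; exact lt_irrefl _ (hσ1.trans hσ2)
    rcases lt_or_gt_of_ne nxy with h1 | h1 <;> rcases lt_or_gt_of_ne nyz with h2 | h2 <;>
      rcases lt_or_gt_of_ne nxz with h3 | h3
    · exact min_le_of_left_le (hf x y z h1 h2).1
    · omega
    · exact min_le_of_left_le
        (aux_main A hs σ hσ _ _ hf hi x y z rfl hσ1 hσ2 h3 h2)
    · exact min_le_of_right_le (by
        have := (hf z x y h3 h1).2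
        rw [hs y z]; exact this)
    · exact min_le_of_right_le (by
        have := (hf y x z h1 h3).1
        rw [hs x y]; exact this)
    · exact min_le_of_left_le
        (aux_main A hs σ hσ _ _ hf' hi' x y z rfl hσ1 hσ2 (by omega) (by omega))
    · omega
    · exact min_le_of_left_le (hf' x y z (by omega) (by omega)).1
  · intro π hπ h1 h2
    have h := aux_main A hs σ hσ _ _ (conv π hπ) (inj π) x y z rfl hσ1 hσ2
      (by exact_mod_cast h1) (by exact_mod_cast h2)
    have h3 := le_min_iff.1 (hπ x z y h1 h2)
    rw [hs z y] at h3
    exact le_min h (h.trans h3.2)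
end

section
/- Let A be a symmetric n×n real matrix that is Robinsonian and let σ be an SFS ordering of A. Then the last vertex of σ is an anchor of A. -/
/-- An edge avoiding `y`. -/
def AvE {V : Type} (A : V → V → ℝ) (y a b : V) : Prop :=
  a ≠ y ∧ b ≠ y ∧ min (A y a) (A y b) < A a b

/-- A path avoiding `y`. -/
def AvP {V : Type} (A : V → V → ℝ) (y a b : V) : Prop :=
  Relation.ReflTransGen (AvE A y) a b

/-- Robinson condition. -/
def Rob {V : Type} (A : V → V → ℝ) (p : V → ℤ) : Prop :=
  ∀ x y w, p x < p y → p y < p w → A x w ≤ A x y ∧ A x w ≤ A y w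

theorem Rob.mirror {V : Type} {A : V → V → ℝ} {p : V → ℤ} (hs : ∀ x y, A x y = A y x)
    (h : Rob A p) : Rob A (fun x => - p x) := by
  intro x y w h1 h2
  have := h w y x (by simpa using h2) (by simpa using h1)
  grind

theorem AvE.symm {V : Type} {A : V → V → ℝ} (hs : ∀ x y, A x y = A y x) {y a b : V}
    (h : AvE A y a b) : AvE A y b a := by
  obtain ⟨h1, h2, h3⟩ := h
  refine ⟨h2, h1, ?_⟩
  rw [min_comm, hs b a]; exact h3

theorem AvE.side {V : Type} {A : V → V → ℝ} {p : V → ℤ} (hs : ∀ x y, A x y = A y x)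
    (hp : Function.Injective p) (hR : Rob A p) {y a b : V}
    (h : AvE A y a b) (ha : p a < p y) : p b < p y := by
  obtain ⟨h1, h2, h3⟩ := h
  by_contra hc
  have hne : p b ≠ p y := fun h => h2 (hp h)
  have h4 := hR a y b ha (by omega)
  have h5 := hs a y
  rcases min_lt_iff.mp h3 with h | h <;> linarith [h4.1, h4.2]

theorem AvP.side {V : Type} {A : V → V → ℝ} {p : V → ℤ} (hs : ∀ x y, A x y = A y x)
    (hp : Function.Injective p) (hR : Rob A p) {y a b : V}
    (h : AvP A y a b) (ha : p a < p y) : p b < p y := by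
  induction h with
  | refl => exact ha
  | tail _ h2 ih => exact h2.side hs hp hR ih

theorem AvE.mono {V : Type} {A : V → V → ℝ} {p : V → ℤ} (hs : ∀ x y, A x y = A y x)
    (hp : Function.Injective p) (hR : Rob A p) {y y' a b : V}
    (h : AvE A y a b) (ha : p a < p y) (hy : p y ≤ p y') : AvE A y' a b := by
  rcases hy.eq_or_lt with hy | hy
  · rw [← hp hy]; exact h
  have hb := h.side hs hp hR ha
  obtain ⟨h1, h2, h3⟩ := h
  refine ⟨?_, ?_, ?_⟩
  · rintro rfl; omega
  · rintro rfl; omega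
  · have e1 := (hR a y y' ha hy).1
    have e2 := (hR b y y' hb hy).1
    rw [hs a y', hs a y] at e1
    rw [hs b y', hs b y] at e2
    exact lt_of_le_of_lt (min_le_min e1 e2) h3

theorem AvP.mono {V : Type} {A : V → V → ℝ} {p : V → ℤ} (hs : ∀ x y, A x y = A y x)
    (hp : Function.Injective p) (hR : Rob A p) {y y' a b : V}
    (h : AvP A y a b) (ha : p a < p y) (hy : p y ≤ p y') : AvP A y' a b := by
  induction h with
  | refl => exact Relation.ReflTransGen.refl
  | tail h1 h2 ih =>
    exact Relation.ReflTransGen.tail ih (h2.mono hs hp hR (AvP.side hs hp hR h1 ha) hy)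

section mirrored
variable {V : Type} {A : V → V → ℝ} {p : V → ℤ}

theorem neg_inj' (hp : Function.Injective p) : Function.Injective (fun x => - p x) := by
  intro x y h
  exact hp (by simpa using h)

theorem AvP.side' (hs : ∀ x y, A x y = A y x)
    (hp : Function.Injective p) (hR : Rob A p) {y a b : V}
    (h : AvP A y a b) (ha : p y < p a) : p y < p b := by
  have := AvP.side (p := fun x => - p x) hs (neg_inj' hp) (hR.mirror hs) h (by simpa using ha)
  simpa using this

theorem AvE.mono' (hs : ∀ x y, A x y = A y x)
    (hp : Function.Injective p) (hR : Rob A p) {y y' a b : V}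
    (h : AvE A y a b) (ha : p y < p a) (hy : p y' ≤ p y) : AvE A y' a b :=
  AvE.mono (p := fun x => - p x) hs (neg_inj' hp) (hR.mirror hs) h
    (by simpa using ha) (by simpa using hy)

theorem AvP.mono' (hs : ∀ x y, A x y = A y x)
    (hp : Function.Injective p) (hR : Rob A p) {y y' a b : V}
    (h : AvP A y a b) (ha : p y < p a) (hy : p y' ≤ p y) : AvP A y' a b :=
  AvP.mono (p := fun x => - p x) hs (neg_inj' hp) (hR.mirror hs) h
    (by simpa using ha) (by simpa using hy)

theorem AvP.cross (hs : ∀ x y, A x y = A y x)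
    (hp : Function.Injective p) (hR : Rob A p) {y a b c : V}
    (h : AvP A y a b) (ha : p y < p a) (hc : p c < p a) (hb : p b < p c) : AvP A y a c := by
  induction h with
  | refl => omega
  | @tail t t' h1 h2 ih =>
    by_cases ht : p t < p c
    · exact ih ht
    by_cases htc : t = c
    · rw [← htc]; exact h1
    have htc' : p c < p t := lt_of_le_of_ne (by omega) (fun h => htc (hp h.symm))
    have s1 := AvP.side' hs hp hR (h1.tail h2) ha
    refine Relation.ReflTransGen.tail h1 ⟨h2.1, ?_, ?_⟩
    · rintro rfl; omega
    · have e1 := (hR t' c t hb htc').2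
      have e2 := (hR y t' t s1 (by omega)).1
      have e3 := h2.2.2
      rw [min_eq_left e2] at e3
      rw [hs t' t, hs c t] at e1
      exact lt_of_le_of_lt (min_le_left _ _) (by linarith)

/-- `r` must come before `l`. -/
def Sbef (A : V → V → ℝ) (p : V → ℤ) (z l r : V) : Prop :=
  ∃ l1 r1, p l1 ≤ p l ∧ p z < p r1 ∧ AvP A r1 l1 z ∧ AvP A l1 r1 r

theorem Sbef.up_r (hs : ∀ x y, A x y = A y x)
    (hp : Function.Injective p) (hR : Rob A p) {z l r r' : V} (hl : p l < p z)
    (hr : p z < p r) (h : Sbef A p z l r) (hrr : p r < p r') : Sbef A p z l r' := by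
  obtain ⟨l1, r1, h1, h2, h3, h4⟩ := h
  by_cases hc : p r1 ≤ p r'
  · exact ⟨l1, r', h1, by omega, h3.mono hs hp hR (by omega) hc, Relation.ReflTransGen.refl⟩
  · exact ⟨l1, r1, h1, h2, h3, h4.cross hs hp hR (by omega) (by omega) hrr⟩

theorem Sbef.up_l {z l l' r : V} (h : Sbef A p z l r) (hll : p l < p l') :
    Sbef A p z l' r := by
  obtain ⟨l1, r1, h1, h2⟩ := h
  exact ⟨l1, r1, by omega, h2⟩

theorem not_AvE {y a b : V} (h1 : a ≠ y) (h2 : b ≠ y) (h : ¬ AvE A y a b) :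
    A a b ≤ A y a ∧ A a b ≤ A y b := by
  unfold AvE at h
  push Not at h
  exact le_min_iff.mp (h h1 h2)

theorem Sbef.z (hs : ∀ x y, A x y = A y x)
    (hp : Function.Injective p) (hR : Rob A p) {z l r : V} (hl : p l < p z)
    (hr : p z < p r)
    (hv : ∀ l r, p l < p z → p z < p r → AvP A r l z → AvP A l r z → False)
    (h : Sbef A p z l r) : A r z ≤ A l r ∧ A r z ≤ A l z := by
  obtain ⟨l1, r1, h1, h2, h3, h4⟩ := h
  apply not_AvE
  · rintro rfl; omega
  · rintro rfl; omega
  · intro hE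
    exact hv l1 r1 (by omega) h2 h3 (h4.tail (hE.mono' hs hp hR (by omega) h1))

theorem Sbef.nz {z l r : V} (hl : p l < p z)
    (hr : p z < p r)
    (h : ¬ Sbef A p z l r) : A l z ≤ A r l ∧ A l z ≤ A r z := by
  apply not_AvE
  · rintro rfl; omega
  · rintro rfl; omega
  · intro hE
    exact h ⟨l, r, le_rfl, hr, Relation.ReflTransGen.single hE, Relation.ReflTransGen.refl⟩

theorem Sbef.rlr (hs : ∀ x y, A x y = A y x)
    (hp : Function.Injective p) (hR : Rob A p) {z l r r' : V} (hl : p l < p z)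
    (hr : p z < p r) (hr' : p z < p r')
    (h : Sbef A p z l r) (h' : ¬ Sbef A p z l r') : A r r' ≤ A l r ∧ A r r' ≤ A l r' := by
  obtain ⟨l1, r1, h1, h2, h3, h4⟩ := h
  apply not_AvE
  · rintro rfl; omega
  · rintro rfl; omega
  · intro hE
    exact h' ⟨l1, r1, h1, h2, h3, (h4.tail (hE.mono' hs hp hR (by omega) h1))⟩

theorem Sbef.lrl (hs : ∀ x y, A x y = A y x)
    (hp : Function.Injective p) (hR : Rob A p) {z l r l' : V} (hl : p l < p z)
    (hr : p z < p r) (hl' : p l' < p z)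
    (h : Sbef A p z l' r) (h' : ¬ Sbef A p z l r) : A l l' ≤ A r l ∧ A l l' ≤ A r l' := by
  have hll : p l < p l' := by
    by_contra hc
    rcases (not_lt.mp hc).eq_or_lt with e | e
    · rw [hp e] at h; exact h' h
    · exact h' (h.up_l e)
  obtain ⟨l1, r1, h1, h2, h3, h4⟩ := h
  apply not_AvE
  · rintro rfl; omega
  · rintro rfl; omega
  · intro hE
    have hl1 : p l < p l1 := by
      by_contra hc
      exact h' ⟨l1, r1, by omega, h2, h3, h4⟩
    have hE1 : AvE A r l l1 := by
      rcases h1.eq_or_lt with e | e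
      · rw [hp e]; exact hE
      refine ⟨hE.1, by rintro rfl; omega, ?_⟩
      have e1 := (hR l l1 l' hl1 e).1
      have e2 := (hR l l' r hll (by omega)).2
      have e3 := hE.2.2
      rw [hs l r, hs l' r] at e2
      rw [min_eq_left e2] at e3
      exact lt_of_le_of_lt (min_le_left _ _) (by linarith)
    by_cases hc : p r1 ≤ p r
    · have h5 := h3.mono hs hp hR (by omega) hc
      exact h' ⟨l, r, le_rfl, hr, Relation.ReflTransGen.head hE1 h5, Relation.ReflTransGen.refl⟩
    · exact h' ⟨l, r1, le_rfl, h2,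
        Relation.ReflTransGen.head (hE1.mono hs hp hR (by omega) (by omega)) h3,
        h4.mono' hs hp hR (by omega) hl1.le⟩

/-- The new strict order. -/
def newLt (A : V → V → ℝ) (p : V → ℤ) (z x y : V) : Prop :=
  (x ≠ z ∧ y = z) ∨ (p x < p y ∧ p y < p z) ∨ (p z < p y ∧ p y < p x) ∨
  (p x < p z ∧ p z < p y ∧ ¬ Sbef A p z x y) ∨ (p y < p z ∧ p z < p x ∧ Sbef A p z y x)

theorem newLt_total (hp : Function.Injective p) (z x y : V) (h : x ≠ y) :
    newLt A p z x y ∨ newLt A p z y x := by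
  have h1 : p x ≠ p y := fun e => h (hp e)
  have h2 : p x = p z → x = z := fun e => hp e
  have h3 : p y = p z → y = z := fun e => hp e
  unfold newLt
  by_cases a : Sbef A p z x y <;> by_cases b : Sbef A p z y x <;> grind

theorem newLt_irrefl (z x : V) : ¬ newLt A p z x x := by
  unfold newLt
  grind

theorem newLt_trans (hs : ∀ x y, A x y = A y x)
    (hp : Function.Injective p) (hR : Rob A p) (z x y w : V) (h1 : newLt A p z x y)
    (h2 : newLt A p z y w) : newLt A p z x w := by
  have U : ∀ l l' r, Sbef A p z l r → p l < p l' → Sbef A p z l' r := fun _ _ _ => Sbef.up_l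
  have W : ∀ l r r', p l < p z → p z < p r → Sbef A p z l r → p r < p r' → Sbef A p z l r' :=
    fun _ _ _ => Sbef.up_r hs hp hR
  have U1 := U w x y
  have U2 := U x y w
  have U3 := U y w x
  have W1 := W y x w
  have W2 := W x w y
  have W3 := W w y x
  have E : p x = p w → x = w := fun e => hp e
  clear U W hs hR
  rcases lt_trichotomy (p x) (p z) with hx | hx | hx <;>
  rcases lt_trichotomy (p y) (p z) with hy | hy | hy <;>
  rcases lt_trichotomy (p w) (p z) with hw | hw | hw <;>
  (try have := hp hx) <;> (try have := hp hy) <;> (try have := hp hw) <;>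
  unfold newLt at * <;> grind

theorem newLt_rob (hs : ∀ x y, A x y = A y x)
    (hp : Function.Injective p) (hR : Rob A p) (z : V)
    (hv : ∀ l r, p l < p z → p z < p r → AvP A r l z → AvP A l r z → False)
    (x y w : V) (h1 : newLt A p z x y)
    (h2 : newLt A p z y w) : A x w ≤ A x y ∧ A x w ≤ A y w := by
  have R1 := hR x y w
  have R2 := hR w y x
  have R3 := hR y x w
  have R4 := hR w x y
  have R5 := hR x w y
  have R6 := hR y w x
  have Z := fun l r a b => Sbef.z (z := z) (l := l) (r := r) hs hp hR a b hv
  have NZ := fun l r => Sbef.nz (A := A) (p := p) (z := z) (l := l) (r := r)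
  have B1 := fun l r r' => Sbef.rlr (z := z) (l := l) (r := r) (r' := r') hs hp hR
  have B2 := fun l r l' => Sbef.lrl (z := z) (l := l) (r := r) (l' := l') hs hp hR
  have s1 := hs x y
  have s2 := hs x w
  have s3 := hs y w
  have Z0 := Z x y
  have NZ0 := NZ x y
  have Z1 := Z y x
  have NZ1 := NZ y x
  have Z2 := Z y w
  have NZ2 := NZ y w
  have Z3 := Z w y
  have NZ3 := NZ w y
  have C1 := B1 y x w
  have C2 := B2 x y w
  have D0 := hR x z w
  have D1 := hR w z x
  have D2 := hR z w y
  have D3 := hR y w z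
  have s4 := hs x z
  have s5 := hs y z
  have s6 := hs w z
  clear Z NZ B1 B2 hs hR hv
  rcases lt_trichotomy (p x) (p z) with hx | hx | hx <;>
  rcases lt_trichotomy (p y) (p z) with hy | hy | hy <;>
  rcases lt_trichotomy (p w) (p z) with hw | hw | hw <;>
  (try have := hp hx) <;> (try have := hp hy) <;> (try have := hp hw) <;>
  unfold newLt at * <;> grind

end mirrored

theorem exists_perm {n : ℕ} (lt : Fin n → Fin n → Prop)
    (ht : ∀ x y, x ≠ y → lt x y ∨ lt y x) (hi : ∀ x, ¬ lt x x)
    (htr : ∀ x y w, lt x y → lt y w → lt x w) :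
    ∃ π : Equiv.Perm (Fin n), ∀ x y, π x < π y ↔ lt x y := by
  classical
  let rk : Fin n → ℕ := fun x => (Finset.univ.filter (fun y => lt y x)).card
  have hlt : ∀ x, rk x < n := by
    intro x
    have : (Finset.univ.filter (fun y => lt y x)).card < (Finset.univ : Finset (Fin n)).card := by
      apply Finset.card_lt_card
      rw [Finset.ssubset_univ_iff]
      intro h
      have : x ∈ Finset.univ.filter (fun y => lt y x) := by rw [h]; simp
      simp [hi] at this
    simpa using this
  have hm : ∀ x y, lt x y → rk x < rk y := by
    intro x y h
    apply Finset.card_lt_card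
    rw [Finset.ssubset_iff_of_subset]
    · exact ⟨x, by simpa using h, by simp [hi]⟩
    · intro w hw
      simp only [Finset.mem_filter, Finset.mem_univ, true_and] at hw ⊢
      exact htr _ _ _ hw h
  let f : Fin n → Fin n := fun x => ⟨rk x, hlt x⟩
  have hf : Function.Injective f := by
    intro x y h
    by_contra hne
    have h' : rk x = rk y := congrArg Fin.val h
    rcases ht x y hne with h1 | h1 <;> have := hm _ _ h1 <;> omega
  refine ⟨Equiv.ofBijective f (Finite.injective_iff_bijective.mp hf), ?_⟩
  intro x y
  change rk x < rk y ↔ lt x y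
  constructor
  · intro h
    by_contra hc
    by_cases hxy : x = y
    · subst hxy; omega
    · rcases ht x y hxy with h1 | h1
      · exact hc h1
      · have := hm _ _ h1; omega
  · exact hm x y

section sfs
variable {V : Type} {A : V → V → ℝ} {p s : V → ℤ}

/-- opposite sides of `z`. -/
def Opp (p : V → ℤ) (z t u : V) : Prop :=
  (p t < p z ∧ p z < p u) ∨ (p u < p z ∧ p z < p t)

theorem first_diff (h0 : ∀ x, 0 ≤ s x)
    (hS : ∀ x y w, s x < s y → s y < s w → A x y < A x w → ∃ u, s u < s x ∧ A u w < A u y)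
    {y e : V} (hye : s y < s e) : ∀ (k : ℕ) (w : V), s w = k → s w < s y → A w y ≠ A w e →
      ∃ w', s w' ≤ s w ∧ (∀ q, s q < s w' → A q y = A q e) ∧ A w' e < A w' y := by
  intro k
  induction k using Nat.strong_induction_on with
  | _ k ih =>
    intro w hk hw hne
    by_cases hq : ∀ q, s q < s w → A q y = A q e
    · refine ⟨w, le_rfl, hq, ?_⟩
      rcases lt_or_gt_of_ne hne with h | h
      · obtain ⟨u, hu, hu2⟩ := hS w y e hw hye h
        have := hq u hu
        linarith
      · exact h
    · push Not at hq
      obtain ⟨q, hq1, hq2⟩ := hq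
      have := h0 q
      obtain ⟨w', a, b, c⟩ := ih (s q).toNat (by omega) q (by omega) (by omega) hq2
      exact ⟨w', by omega, b, c⟩

theorem opp_le_s7 (hs : ∀ x y, A x y = A y x) (hR : Rob A p) {z t u : V} (h : Opp p z t u) :
    A t u ≤ A t z := by
  rcases h with ⟨a, b⟩ | ⟨a, b⟩
  · exact (hR t z u a b).1
  · have := (hR u z t a b).2
    rw [hs t u, hs t z]; exact this

theorem opp_of (hs : ∀ x y, A x y = A y x) (hp : Function.Injective p) (hR : Rob A p)
    {z q u v : V} (h : Opp p z u v) (hq : q ≠ z) (hl : A q z < A q v) : Opp p z q u := by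
  have h1 : ¬ Opp p z q v := fun h => by have := opp_le_s7 hs hR h; linarith
  have h2 : p q ≠ p z := fun e => hq (hp e)
  unfold Opp at *
  omega

theorem descent_s7 (hs : ∀ x y, A x y = A y x) (hp : Function.Injective p) (hR : Rob A p)
    (h0 : ∀ x, 0 ≤ s x)
    (hS : ∀ x y w, s x < s y → s y < s w → A x y < A x w → ∃ u, s u < s x ∧ A u w < A u y)
    (z : V) (hz : ∀ x, s x ≤ s z) :
    ∀ (k : ℕ) (t u e : V), s t = k → s t < s u → s u < s e → Opp p z t u → A t z < A t e →
      (∀ r, s r < s t → A r e = A r z) → False := by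
  intro k
  induction k using Nat.strong_induction_on with
  | _ k ih =>
    intro t u e hk htu hue ho hte htie
    have h1 := opp_le_s7 hs hR ho
    obtain ⟨a, ha, ha2⟩ := hS t u e htu hue (by linarith)
    have := h0 a
    obtain ⟨q, hq1, hq2, hq3⟩ := first_diff h0 hS hue (s a).toNat a (by omega) (by omega)
      (ne_of_gt ha2)
    have := h0 q
    have e1 := htie q (by omega)
    have hqz : q ≠ z := by
      rintro rfl
      have := hz t
      omega
    have hl : A q z < A q u := by rw [← e1]; exact hq3
    refine ih (s q).toNat (by omega) q t u (by omega) (by omega) htu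
      (opp_of hs hp hR ho hqz hl) hl ?_
    intro r hr
    rw [hq2 r hr]
    exact htie r (by omega)

theorem tied (hs : ∀ x y, A x y = A y x) (hp : Function.Injective p) (hR : Rob A p)
    (hsi : Function.Injective s)
    (h0 : ∀ x, 0 ≤ s x)
    (hS : ∀ x y w, s x < s y → s y < s w → A x y < A x w → ∃ u, s u < s x ∧ A u w < A u y)
    (z : V) (hz : ∀ x, s x ≤ s z) {u v w : V} (huv : s u < s v) (ho : Opp p z u v)
    (hw : s w ≤ s u) : A w v = A w z := by
  by_contra hne
  have hvz : s v < s z := by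
    refine lt_of_le_of_ne (hz v) (fun e => ?_)
    have := hsi e
    subst this
    unfold Opp at ho
    omega
  have := h0 w
  obtain ⟨w', h1, h2, h3⟩ := first_diff h0 hS hvz (s w).toNat w (by omega) (by omega) hne
  by_cases hwu : w' = u
  · subst hwu
    have := opp_le_s7 hs hR ho
    linarith
  have hwu' : s w' ≠ s u := fun e => hwu (hsi e)
  have hqz : w' ≠ z := by
    rintro rfl
    omega
  have := h0 w'
  exact descent_s7 hs hp hR h0 hS z hz (s w').toNat w' u v (by omega) (by omega) huv
    (opp_of hs hp hR ho hqz h3) h3 h2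

theorem no_path (hs : ∀ x y, A x y = A y x) (hp : Function.Injective p) (hR : Rob A p)
    (hsi : Function.Injective s)
    (h0 : ∀ x, 0 ≤ s x)
    (hS : ∀ x y w, s x < s y → s y < s w → A x y < A x w → ∃ u, s u < s x ∧ A u w < A u y)
    (z : V) (hz : ∀ x, s x ≤ s z) {u v : V} (huv : s u < s v) (hu : p u < p z)
    (hv : p z < p v) (hN : AvP A v u z) : False := by
  have T := fun u v w => tied hs hp hR hsi h0 hS z hz (u := u) (v := v) (w := w)
  have key : ∀ b, AvP A v u b → p b < p z ∧ s b < s v := by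
    intro b hb
    induction hb with
    | refl => exact ⟨hu, huv⟩
    | @tail a b h1 h2 ih =>
      obtain ⟨ha1, ha2⟩ := ih
      have e1 := T a v a ha2 (Or.inl ⟨ha1, hv⟩) le_rfl
      have hbv := h2.side hs hp hR (by omega)
      have h3 := h2.2.2
      by_cases hbz : p b < p z
      · refine ⟨hbz, ?_⟩
        by_contra hc
        have hne : s b ≠ s v := fun e => h2.2.1 (hsi e)
        have e2 := T v b v (by omega) (Or.inr ⟨hbz, hv⟩) le_rfl
        have e3 := T v b a (by omega) (Or.inr ⟨hbz, hv⟩) ha2.le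
        have e4 := (hR a z v ha1 hv).2
        have := hs a v
        have := hs z v
        rcases min_lt_iff.mp h3 with h | h <;> linarith
      · exfalso
        have e2 := (hR a b v (by omega) hbv).2
        have e3 : A a b ≤ A a z := by
          by_cases e : b = z
          · rw [e]
          · have : p b ≠ p z := fun h => e (hp h)
            exact (hR a z b ha1 (by omega)).1
        have := hs a v
        have := hs b v
        rcases min_lt_iff.mp h3 with h | h <;> linarith
  have := key z hN
  omega

end sfs

/-- The last vertex of an SFS ordering of a symmetric Robinsonian matrix
`A` is an anchor of `A`. -/
theorem stmt_7 {n : ℕ} (A : Matrix (Fin n) (Fin n) ℝ) (hA : A.IsSymm)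
    (hRob : IsRobinsonian A)
    (σ : Equiv.Perm (Fin n)) (hσ : IsSFSOrdering A σ)
    (z : Fin n) (hz : IsLastOf σ z) :
    IsAnchor A z := by
  obtain ⟨π, hπ⟩ := hRob
  have hs : ∀ x y, A x y = A y x := fun x y => (hA.apply x y).symm
  let p : Fin n → ℤ := fun x => ((π x : ℕ) : ℤ)
  let s : Fin n → ℤ := fun x => ((σ x : ℕ) : ℤ)
  have pl : ∀ x y, p x < p y ↔ π x < π y := fun x y => by simp [p]
  have sl : ∀ x y, s x < s y ↔ σ x < σ y := fun x y => by simp [s]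
  have hp : Function.Injective p := fun x y h => by
    apply π.injective; apply Fin.ext; simpa [p] using h
  have hsi : Function.Injective s := fun x y h => by
    apply σ.injective; apply Fin.ext; simpa [s] using h
  have hR : Rob A p := fun x y w h1 h2 =>
    le_min_iff.mp (hπ x y w ((pl _ _).mp h1) ((pl _ _).mp h2))
  have h0 : ∀ x, 0 ≤ s x := fun x => by simp [s]
  have hS : ∀ x y w, s x < s y → s y < s w → A x y < A x w →
      ∃ u, s u < s x ∧ A u w < A u y := by
    intro x y w
    simp only [sl]
    exact hσ x y w
  have hz' : ∀ x, s x ≤ s z := fun x => by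
    have := hz x
    simpa [s] using this
  have hv : ∀ l r, p l < p z → p z < p r → AvP A r l z → AvP A l r z → False := by
    intro l r hl hr h1 h2
    have hne : s l ≠ s r := fun e => by
      have := hsi e
      subst this
      omega
    rcases lt_or_gt_of_ne hne with h | h
    · exact no_path hs hp hR hsi h0 hS z hz' h hl hr h1
    · exact no_path (p := fun x => - p x) hs (neg_inj' hp) (hR.mirror hs) hsi h0 hS z hz' h
        (by simpa using hr) (by simpa using hl) h2
  obtain ⟨τ, hτ⟩ := exists_perm (newLt A p z) (newLt_total hp z) (newLt_irrefl z)
    (newLt_trans hs hp hR z)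
  refine ⟨τ, ?_, ?_⟩
  · intro x y w h1 h2
    exact le_min_iff.mpr (newLt_rob hs hp hR z hv x y w ((hτ _ _).mp h1) ((hτ _ _).mp h2))
  · intro y
    by_cases h : y = z
    · rw [h]
    · exact ((hτ y z).mpr (Or.inl ⟨h, rfl⟩)).le
end

section
/- Let A be a symmetric n×n real matrix that is Robinsonian and let σ be a good SFS ordering of A whose first vertex is a and whose last vertex is b. Then a and b are opposite anchors of A, i.e., there exists a Robinson ordering of A whose first element is a and whose last element is b. -/
namespace SFSProof

def Rob {V : Type*} (A : V → V → ℝ) (S : Finset V) (f : V → ℤ) : Prop :=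
  Set.InjOn f S ∧ ∀ x ∈ S, ∀ y ∈ S, ∀ z ∈ S, f x < f y → f y < f z →
    A x z ≤ A x y ∧ A x z ≤ A y z

def SFS {V : Type*} (A : V → V → ℝ) (S : Finset V) (s : V → ℤ) : Prop :=
  Set.InjOn s S ∧ ∀ x ∈ S, ∀ y ∈ S, ∀ z ∈ S, s x < s y → s y < s z → A x y < A x z →
    ∃ u ∈ S, s u < s x ∧ A u z < A u y

def Side {V : Type*} (S K : Finset V) (f : V → ℤ) : Prop :=
  ∀ k ∈ K, (∀ x ∈ S, x ∉ K → f k < f x) ∨ (∀ x ∈ S, x ∉ K → f x < f k)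

theorem Rob.neg {V : Type*} {A : V → V → ℝ} (hA : ∀ x y, A x y = A y x) {S : Finset V}
    {f : V → ℤ} (h : Rob A S f) : Rob A S (fun x => - f x) := by
  refine ⟨fun x hx y hy hxy => h.1 hx hy (by simpa using hxy), ?_⟩
  intro x hx y hy z hz h1 h2
  have := h.2 z hz y hy x hx (by simpa using h2) (by simpa using h1)
  rw [hA x z, hA x y, hA y z]
  exact ⟨this.2, this.1⟩

theorem exists_lex {V : Type*} [Fintype V] (cl f : V → ℤ) :
    ∃ F : V → ℤ, ∀ x y, F x < F y ↔ cl x < cl y ∨ (cl x = cl y ∧ f x < f y) := by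
  classical
  let g : V → ℤ ×ₗ ℤ := fun x => toLex (cl x, f x)
  have hg : ∀ x y, g x < g y ↔ cl x < cl y ∨ (cl x = cl y ∧ f x < f y) := by
    intro x y
    simp [g, Prod.Lex.toLex_lt_toLex]
  refine ⟨fun x => ((Finset.univ.filter (fun y => g y < g x)).card : ℤ), ?_⟩
  intro x y
  rw [← hg]
  have mono : ∀ x y, g x ≤ g y → (Finset.univ.filter (fun z => g z < g x)).card ≤
      (Finset.univ.filter (fun z => g z < g y)).card := by
    intro x y h
    apply Finset.card_le_card
    intro z hz
    simp only [Finset.mem_filter, Finset.mem_univ, true_and] at hz ⊢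
    exact lt_of_lt_of_le hz h
  constructor
  · intro h
    by_contra h'
    have := mono y x (not_lt.1 h')
    push_cast at h
    omega
  · intro h
    have : (Finset.univ.filter (fun z => g z < g x)).card <
      (Finset.univ.filter (fun z => g z < g y)).card := by
      apply Finset.card_lt_card
      rw [Finset.ssubset_iff_of_subset]
      · exact ⟨x, by simp [h], by simp⟩
      · intro z hz
        simp only [Finset.mem_filter, Finset.mem_univ, true_and] at hz ⊢
        exact lt_trans hz h
    simpa using this

theorem exists_shrink {V : Type*} [DecidableEq V] {A : V → V → ℝ}
    (hA : ∀ x y, A x y = A y x) {S : Finset V} {f s : V → ℤ}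
    (hf : Rob A S f) (hs : SFS A S s) {p b : V} (hp : p ∈ S) (hb : b ∈ S) (hpb : b ≠ p)
    (hp1 : ∀ x ∈ S, s p ≤ s x) (hb1 : ∀ x ∈ S, s x ≤ s b) :
    ∃ K ⊆ S, b ∈ K ∧ p ∉ K ∧ Side S K f ∧
      (∀ x ∈ S, x ∉ K → ∀ k ∈ K, ∀ k' ∈ K, A x k = A x k') := by
  let Inv : Finset V → Prop := fun K => K ⊆ S ∧ b ∈ K ∧ p ∉ K ∧ Side S K f ∧
    (∀ x ∈ S, x ∉ K → ∀ k ∈ K, s x < s k)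
  have h0 : ∃ m, ∃ K, Inv K ∧ K.card = m := by
    refine ⟨_, S.erase p, ⟨Finset.erase_subset _ _, by simp [hb, hpb], by simp, ?_, ?_⟩, rfl⟩
    · intro k hk
      simp only [Finset.mem_erase] at hk
      have hne : f k ≠ f p := fun h => hk.1 (hf.1 hk.2 hp h)
      rcases lt_or_gt_of_ne hne with h | h
      · left; intro x hx hx'
        have : x = p := by by_contra h; exact hx' (by simp [h, hx])
        rw [this]; exact h
      · right; intro x hx hx'
        have : x = p := by by_contra h; exact hx' (by simp [h, hx])
        rw [this]; exact h
    · intro x hx hx' k hk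
      have : x = p := by by_contra h; exact hx' (by simp [h, hx])
      simp only [Finset.mem_erase] at hk
      rw [this]
      exact lt_of_le_of_ne (hp1 k hk.2) (fun h => hk.1 (hs.1 hk.2 hp h.symm))
  classical
  obtain ⟨K, ⟨hKS, hbK, hpK, hside, hfin⟩, hcard⟩ := Nat.find_spec h0
  refine ⟨K, hKS, hbK, hpK, hside, ?_⟩
  by_contra hcon
  let B : Finset V := S.filter (fun x => x ∉ K ∧ ∃ k ∈ K, ∃ k' ∈ K, A x k ≠ A x k')
  have hB : B.Nonempty := by
    push Not at hcon
    obtain ⟨x, hx, hxK, k, hk, k', hk', hne⟩ := hcon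
    exact ⟨x, by simp only [B, Finset.mem_filter]; exact ⟨hx, hxK, k, hk, k', hk', hne⟩⟩
  obtain ⟨q, hqB, hqmin⟩ := Finset.exists_min_image B s hB
  simp only [B, Finset.mem_filter] at hqB hqmin
  obtain ⟨hqS, hqK, k1, hk1, k2, hk2, hne⟩ := hqB
  obtain ⟨m, hm, hmmin⟩ := Finset.exists_min_image K (A q) ⟨b, hbK⟩
  let K' := K.filter (fun k => A q k = A q m)
  have hmem : ∀ k, k ∈ K' ↔ k ∈ K ∧ A q k = A q m := by intro k; simp [K']
  have hsplit : ∀ y ∈ K, y ∉ K' → A q m < A q y := by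
    intro y hy hy'
    exact lt_of_le_of_ne (hmmin y hy) (fun h => hy' ((hmem y).2 ⟨hy, h.symm⟩))
  have hfinK : ∀ y ∈ K, y ∉ K' → ∀ z ∈ K', s y < s z := by
    intro y hy hy' z hz
    have hz' := (hmem z).1 hz
    by_contra hlt
    have hzy : s z < s y := by
      rcases lt_or_eq_of_le (not_lt.1 hlt) with h | h
      · exact h
      · exact absurd (hs.1 (hKS hz'.1) (hKS hy) h) (fun h => hy' (h ▸ hz))
    obtain ⟨u, huS, hu, hlt⟩ := hs.2 q hqS z (hKS hz'.1) y (hKS hy) (hfin q hqS hqK z hz'.1) hzy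
      (by rw [hz'.2]; exact hsplit y hy hy')
    have huK : u ∉ K := by
      intro huK
      have := hfin q hqS hqK u huK
      omega
    have := hqmin u ⟨huS, huK, y, hy, z, hz'.1, ne_of_lt hlt⟩
    omega
  have hK'sub : K' ⊆ K := Finset.filter_subset _ _
  have hInv : Inv K' := by
    refine ⟨hK'sub.trans hKS, ?_, fun h => hpK (hK'sub h), ?_, ?_⟩
    · by_contra hb'
      have h1 := hfinK b hbK hb' m ((hmem m).2 ⟨hm, rfl⟩)
      have h2 := hb1 m (hKS hm)
      omega
    · intro k hk
      have hk' := (hmem k).1 hk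
      rcases hside k hk'.1 with h | h
      · left
        intro x hx hx'
        by_cases hxK : x ∈ K
        · rcases hside x hxK with h' | h'
          · by_contra hlt
            have hne : f x ≠ f k := fun h => hx' ((hf.1 hx (hKS hk'.1) h) ▸ hk)
            have := hf.2 x hx k (hKS hk'.1) q hqS (by omega) (h q hqS hqK)
            have h3 := hsplit x hxK hx'
            rw [hA x q, hA k q, hk'.2] at this
            linarith [this.2]
          · exact (h q hqS hqK).trans (h' q hqS hqK)
        · exact h x hx hxK
      · right
        intro x hx hx'
        by_cases hxK : x ∈ K
        · rcases hside x hxK with h' | h'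
          · exact (h' q hqS hqK).trans (h q hqS hqK)
          · by_contra hlt
            have hne : f x ≠ f k := fun h => hx' ((hf.1 hx (hKS hk'.1) h) ▸ hk)
            have := hf.2 q hqS k (hKS hk'.1) x hx (h q hqS hqK) (by omega)
            have h3 := hsplit x hxK hx'
            rw [hk'.2] at this
            linarith [this.1]
        · exact h x hx hxK
    · intro x hx hx' k hk
      by_cases hxK : x ∈ K
      · exact hfinK x hxK hx' k hk
      · exact hfin x hx hxK k (hK'sub hk)
  have hlt : K'.card < K.card := by
    apply Finset.card_lt_card
    rw [Finset.ssubset_iff_of_subset hK'sub]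
    by_contra hall
    push Not at hall
    have e1 := ((hmem k1).1 (hall k1 hk1)).2
    have e2 := ((hmem k2).1 (hall k2 hk2)).2
    exact hne (e1.trans e2.symm)
  have := Nat.find_min' h0 ⟨K', hInv, rfl⟩
  omega

theorem SFS.restrict {V : Type*} {A : V → V → ℝ} {S K : Finset V} {s : V → ℤ}
    (hs : SFS A S s) (hK : K ⊆ S)
    (hom : ∀ x ∈ S, x ∉ K → ∀ k ∈ K, ∀ k' ∈ K, A x k = A x k') : SFS A K s := by
  refine ⟨hs.1.mono (by exact_mod_cast hK), ?_⟩
  intro x hx y hy z hz h1 h2 h3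
  obtain ⟨u, hu, h4, h5⟩ := hs.2 x (hK hx) y (hK hy) z (hK hz) h1 h2 h3
  refine ⟨u, ?_, h4, h5⟩
  by_contra huK
  exact absurd (hom u hu huK z hz y hy) (ne_of_lt h5)

/-- put `S \ K` first, then `K`. -/
theorem glue_first {V : Type*} [Fintype V] [DecidableEq V] {A : V → V → ℝ}
    {S K : Finset V} {f r : V → ℤ} (hf : Rob A S f) (hr : Rob A K r)
    (h1 : ∀ x ∈ S, x ∉ K → ∀ k ∈ K, ∀ k' ∈ K, A x k = A x k')
    (h2 : ∀ x ∈ S, x ∉ K → ∀ k ∈ K, ∀ k' ∈ K, k ≠ k' → A x k ≤ A k k')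
    (h3 : ∀ x ∈ S, x ∉ K → ∀ y ∈ S, y ∉ K → f x < f y → ∀ k ∈ K,
      A x k ≤ A x y ∧ A x k ≤ A y k) :
    ∃ F : V → ℤ, Rob A S F ∧ (∀ x ∈ S, x ∉ K → ∀ k ∈ K, F x < F k) ∧
      (∀ x ∈ K, ∀ y ∈ K, F x < F y ↔ r x < r y) ∧
      (∀ x ∈ S, x ∉ K → ∀ y ∈ S, y ∉ K → (F x < F y ↔ f x < f y)) := by
  obtain ⟨F, hF⟩ := exists_lex (fun x : V => if x ∈ K then (1 : ℤ) else 0)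
    (fun x => if x ∈ K then r x else f x)
  have a1 : ∀ x ∈ K, ∀ y ∈ K, F x < F y ↔ r x < r y := by
    intro x hx y hy; rw [hF]; simp [hx, hy]
  have a2 : ∀ x ∉ K, ∀ y ∉ K, F x < F y ↔ f x < f y := by
    intro x hx y hy; rw [hF]; simp [hx, hy]
  have a3 : ∀ x ∉ K, ∀ y ∈ K, F x < F y := by
    intro x hx y hy; rw [hF]; simp [hx, hy]
  refine ⟨F, ⟨?_, ?_⟩, fun x _ hx k hk => a3 x hx k hk, a1,
    fun x _ hx y _ hy => a2 x hx y hy⟩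
  · intro x hx y hy hxy
    by_cases hxK : x ∈ K <;> by_cases hyK : y ∈ K
    · apply hr.1 hxK hyK
      have := a1 x hxK y hyK
      have := a1 y hyK x hxK
      omega
    · have := a3 y hyK x hxK; omega
    · have := a3 x hxK y hyK; omega
    · apply hf.1 hx hy
      have := a2 x hxK y hyK
      have := a2 y hyK x hxK
      omega
  · intro x hx y hy z hz hxy hyz
    by_cases hxK : x ∈ K
    · have hyK : y ∈ K := by by_contra h; have := a3 y h x hxK; omega
      have hzK : z ∈ K := by by_contra h; have := a3 z h y hyK; omega
      exact hr.2 x hxK y hyK z hzK ((a1 _ hxK _ hyK).1 hxy) ((a1 _ hyK _ hzK).1 hyz)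
    · by_cases hyK : y ∈ K
      · have hzK : z ∈ K := by by_contra h; have := a3 z h y hyK; omega
        refine ⟨(h1 x hx hxK z hzK y hyK).le, ?_⟩
        rw [h1 x hx hxK z hzK y hyK]
        exact h2 x hx hxK y hyK z hzK (by rintro rfl; omega)
      · have hxy' := (a2 _ hxK _ hyK).1 hxy
        by_cases hzK : z ∈ K
        · exact h3 x hx hxK y hy hyK hxy' z hzK
        · exact hf.2 x hx y hy z hz hxy' ((a2 _ hyK _ hzK).1 hyz)

/-- all of `K` to the right. -/
theorem glue_right {V : Type*} [Fintype V] [DecidableEq V] {A : V → V → ℝ}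
    (hA : ∀ x y, A x y = A y x)
    {S K : Finset V} {f r : V → ℤ} (hf : Rob A S f) (hr : Rob A K r) (hK : K ⊆ S)
    (h1 : ∀ x ∈ S, x ∉ K → ∀ k ∈ K, ∀ k' ∈ K, A x k = A x k')
    (hR : ∀ k ∈ K, ∀ x ∈ S, x ∉ K → f x < f k) :
    ∃ F : V → ℤ, Rob A S F ∧ (∀ x ∈ S, x ∉ K → ∀ k ∈ K, F x < F k) ∧
      (∀ x ∈ K, ∀ y ∈ K, F x < F y ↔ r x < r y) ∧
      (∀ x ∈ S, x ∉ K → ∀ y ∈ S, y ∉ K → (F x < F y ↔ f x < f y)) := by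
  apply glue_first hf hr h1
  · intro x hx hxK k hk k' hk' hne
    have hne' : f k ≠ f k' := fun h => hne (hf.1 (hK hk) (hK hk') h)
    rcases lt_or_gt_of_ne hne' with h | h
    · rw [h1 x hx hxK k hk k' hk']
      exact (hf.2 x hx k (hK hk) k' (hK hk') (hR k hk x hx hxK) h).2
    · rw [hA k k']
      exact (hf.2 x hx k' (hK hk') k (hK hk) (hR k' hk' x hx hxK) h).2
  · intro x hx hxK y hy hyK hxy k hk
    exact hf.2 x hx y hy k (hK hk) hxy (hR k hk y hy hyK)

theorem glue_main {V : Type*} [Fintype V] [DecidableEq V] {A : V → V → ℝ}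
    (hA : ∀ x y, A x y = A y x)
    {S K : Finset V} {f r : V → ℤ} (hf : Rob A S f) (hr : Rob A K r) (hK : K ⊆ S)
    (h1 : ∀ x ∈ S, x ∉ K → ∀ k ∈ K, ∀ k' ∈ K, A x k = A x k')
    (hside : Side S K f) {p b : V} (hp : p ∈ S) (hpK : p ∉ K) (hb : b ∈ K)
    (hbr : ∀ x ∈ K, r x ≤ r b) (hbR : f p < f b) :
    ∃ F : V → ℤ, Rob A S F ∧ ∀ x ∈ S, F x ≤ F b := by
  have fin1 : ∀ F : V → ℤ, (∀ x ∈ S, x ∉ K → ∀ k ∈ K, F x < F k) →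
      (∀ x ∈ K, ∀ y ∈ K, F x < F y ↔ r x < r y) → ∀ x ∈ S, F x ≤ F b := by
    intro F h2 h3 x hx
    by_cases hxK : x ∈ K
    · have := h3 b hb x hxK
      have := hbr x hxK
      omega
    · exact (h2 x hx hxK b hb).le
  -- left / right characterised by p
  have hL : ∀ k ∈ K, f k < f p → ∀ x ∈ S, x ∉ K → f k < f x := by
    intro k hk h
    rcases hside k hk with h' | h'
    · exact h'
    · have := h' p hp hpK; omega
  have hR : ∀ k ∈ K, ¬ f k < f p → ∀ x ∈ S, x ∉ K → f x < f k := by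
    intro k hk h
    rcases hside k hk with h' | h'
    · have := h' p hp hpK; omega
    · exact h'
  by_cases hl : ∃ l ∈ K, f l < f p
  swap
  · push Not at hl
    obtain ⟨F, hF, h2, h3, _⟩ := glue_right hA hf hr hK h1
      (fun k hk => hR k hk (by have := hl k hk; omega))
    exact ⟨F, hF, fin1 F h2 h3⟩
  obtain ⟨l0, hl0, hl0p⟩ := hl
  obtain ⟨c, hc⟩ : ∃ c, c = A p b := ⟨_, rfl⟩
  have hle : ∀ x ∈ S, x ∉ K → ∀ y ∈ S, y ∉ K → f x < f y → A x b = A y b := by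
    intro x hx hxK y hy hyK hxy
    apply le_antisymm
    · exact (hf.2 x hx y hy b (hK hb) hxy (hR b hb (by omega) y hy hyK)).2
    · have := (hf.2 l0 (hK hl0) x hx y hy (hL l0 hl0 hl0p x hx hxK) hxy).1
      rw [hA l0 y, hA l0 x, h1 x hx hxK l0 hl0 b hb, h1 y hy hyK l0 hl0 b hb] at this
      exact this
  have hconst : ∀ x ∈ S, x ∉ K → ∀ k ∈ K, A x k = c := by
    intro x hx hxK k hk
    rw [h1 x hx hxK k hk b hb, hc]
    rcases lt_trichotomy (f x) (f p) with h | h | h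
    · exact hle x hx hxK p hp hpK h
    · rw [hf.1 hx hp h]
    · exact (hle p hp hpK x hx hxK h).symm
  have hMM' : ∀ x ∈ S, x ∉ K → ∀ y ∈ S, y ∉ K → f x < f y → c ≤ A x y := by
    intro x hx hxK y hy hyK hxy
    rw [← hconst x hx hxK b hb]
    exact (hf.2 x hx y hy b (hK hb) hxy (hR b hb (by omega) y hy hyK)).1
  have hcross : ∀ x ∈ K, ∀ y ∈ K, f x < f p → ¬ f y < f p → A x y ≤ c := by
    intro x hx y hy hxp hyp
    rw [← hconst p hp hpK y hy]
    exact (hf.2 x (hK hx) p hp y (hK hy) hxp (hR y hy hyp p hp hpK)).2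
  have hsameL : ∀ x ∈ K, ∀ y ∈ K, x ≠ y → f x < f p → f y < f p → c ≤ A x y := by
    intro x hx y hy hne hxp hyp
    rcases lt_or_gt_of_ne (fun h => hne (hf.1 (hK hx) (hK hy) h)) with h | h
    · rw [← hconst p hp hpK x hx, hA p x]
      exact (hf.2 x (hK hx) y (hK hy) p hp h hyp).1
    · rw [← hconst p hp hpK y hy, hA p y, hA x y]
      exact (hf.2 y (hK hy) x (hK hx) p hp h hxp).1
  have hsameR : ∀ x ∈ K, ∀ y ∈ K, x ≠ y → ¬ f x < f p → ¬ f y < f p → c ≤ A x y := by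
    intro x hx y hy hne hxp hyp
    rcases lt_or_gt_of_ne (fun h => hne (hf.1 (hK hx) (hK hy) h)) with h | h
    · rw [← hconst p hp hpK y hy]
      exact (hf.2 p hp x (hK hx) y (hK hy) (hR x hx hxp p hp hpK) h).2
    · rw [← hconst p hp hpK x hx, hA x y]
      exact (hf.2 p hp y (hK hy) x (hK hx) (hR y hy hyp p hp hpK) h).2
  -- if the r-extremes of an interval have similarity at least c, so do all pairs inside
  have hinter : ∀ x ∈ K, ∀ y ∈ K, c ≤ A x y → ∀ u ∈ K, ∀ v ∈ K, r x ≤ r u → r u < r v →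
      r v ≤ r y → c ≤ A u v := by
    intro x hx y hy hcxy u hu v hv h1 h2 h3
    have s1 : c ≤ A u y := by
      rcases lt_or_eq_of_le h1 with h | h
      · exact hcxy.trans (hr.2 x hx u hu y hy h (by omega)).2
      · rw [← hr.1 hx hu h]; exact hcxy
    rcases lt_or_eq_of_le h3 with h | h
    · exact s1.trans (hr.2 u hu v hv y hy h2 h).1
    · rw [hr.1 hv hy h]; exact s1
  obtain ⟨k1, hk1, hk1min⟩ := Finset.exists_min_image K r ⟨b, hb⟩
  by_cases hk1p : f k1 < f p
  swap
  · -- everything in K at least c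
    have hk1b : k1 ≠ b := by
      rintro rfl
      have e1 := hk1min l0 hl0
      have e2 := hbr l0 hl0
      have : l0 = k1 := hr.1 hl0 hb (by omega)
      rw [this] at hl0p; omega
    have hbig := hsameR k1 hk1 b hb hk1b hk1p (by omega)
    obtain ⟨F, hF, h2, h3, _⟩ := glue_first hf hr h1
      (by
        intro x hx hxK k hk k' hk' hne
        rw [hconst x hx hxK k hk]
        rcases lt_or_gt_of_ne (fun h => hne (hr.1 hk hk' h)) with h | h
        · exact hinter k1 hk1 b hb hbig k hk k' hk' (hk1min k hk) h (hbr k' hk')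
        · rw [hA k k']
          exact hinter k1 hk1 b hb hbig k' hk' k hk (hk1min k' hk') h (hbr k hk))
      (by
        intro x hx hxK y hy hyK hxy k hk
        rw [hconst x hx hxK k hk, hconst y hy hyK k hk]
        exact ⟨hMM' x hx hxK y hy hyK hxy, le_rfl⟩)
    exact ⟨F, hF, fin1 F h2 h3⟩
  · obtain ⟨l, hl, hlmax⟩ := Finset.exists_max_image (K.filter (fun k => f k < f p)) r
      ⟨k1, by simp [hk1, hk1p]⟩
    simp only [Finset.mem_filter] at hl hlmax
    obtain ⟨hlK, hlp⟩ := hl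
    have hP : ∀ u ∈ K, ∀ v ∈ K, r u < r v → r v ≤ r l → c ≤ A u v := by
      intro u hu v hv huv hvl
      have hne : k1 ≠ l := by
        rintro rfl
        have := hk1min u hu
        omega
      exact hinter k1 hk1 l hlK (hsameL k1 hk1 l hlK hne hk1p hlp) u hu v hv (hk1min u hu) huv hvl
    have hright : ∀ v ∈ K, r l < r v → ¬ f v < f p := by
      intro v hv h h'
      have := hlmax v ⟨hv, h'⟩
      omega
    have hQ : ∀ u ∈ K, ∀ v ∈ K, r u < r v → r l < r u → c ≤ A u v := by
      intro u hu v hv huv hlu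
      exact hsameR u hu v hv (by rintro rfl; omega) (hright u hu hlu) (hright v hv (by omega))
    have hPQ : ∀ u ∈ K, ∀ v ∈ K, r u ≤ r l → r l < r v → A u v ≤ c := by
      intro u hu v hv hul hlv
      have h := hcross l hlK v hv hlp (hright v hv hlv)
      rcases lt_or_eq_of_le hul with h' | h'
      · exact (hr.2 u hu l hlK v hv h' hlv).2.trans h
      · rw [hr.1 hu hlK h']; exact h
    have hlb : r l < r b := by
      have := hbr l hlK
      rcases lt_or_eq_of_le this with h | h
      · exact h
      · have := hr.1 hlK hb h
        rw [this] at hlp; omega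
    obtain ⟨F, hF⟩ := exists_lex
      (fun x : V => if x ∈ K then (if r x ≤ r l then (0 : ℤ) else 2) else 1)
      (fun x => if x ∈ K then r x else f x)
    have a1 : ∀ x ∈ K, ∀ y ∈ K, F x < F y ↔ r x < r y := by
      intro x hx y hy; rw [hF]; simp only [hx, hy, if_true]; split_ifs <;> omega
    have a2 : ∀ x ∉ K, ∀ y ∉ K, F x < F y ↔ f x < f y := by
      intro x hx y hy; rw [hF]; simp [hx, hy]
    have a3 : ∀ x ∉ K, ∀ y ∈ K, F x < F y ↔ r l < r y := by
      intro x hx y hy; rw [hF]; simp only [hx, hy, if_true, if_false]; split_ifs <;> omega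
    have a4 : ∀ x ∉ K, ∀ y ∈ K, F y < F x ↔ r y ≤ r l := by
      intro x hx y hy; rw [hF]; simp only [hx, hy, if_true, if_false]; split_ifs <;> omega
    refine ⟨F, ⟨?_, ?_⟩, ?_⟩
    · intro x hx y hy hxy
      by_cases hxK : x ∈ K <;> by_cases hyK : y ∈ K
      · apply hr.1 hxK hyK
        have := a1 x hxK y hyK
        have := a1 y hyK x hxK
        omega
      · have := a3 y hyK x hxK; have := a4 y hyK x hxK; omega
      · have := a3 x hxK y hyK; have := a4 x hxK y hyK; omega
      · apply hf.1 hx hy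
        have := a2 x hxK y hyK
        have := a2 y hyK x hxK
        omega
    · intro x hx y hy z hz hxy hyz
      have hxz := hxy.trans hyz
      by_cases hxK : x ∈ K <;> by_cases hyK : y ∈ K <;> by_cases hzK : z ∈ K
      · rw [a1 _ hxK _ hyK] at hxy
        rw [a1 _ hyK _ hzK] at hyz
        exact hr.2 x hxK y hyK z hzK hxy hyz
      · rw [a1 _ hxK _ hyK] at hxy
        rw [a4 _ hzK _ hyK] at hyz
        rw [hA x z, hA y z, hconst z hz hzK x hxK, hconst z hz hzK y hyK]
        exact ⟨hP x hxK y hyK hxy hyz, le_rfl⟩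
      · rw [a4 _ hyK _ hxK] at hxy
        rw [a3 _ hyK _ hzK] at hyz
        rw [hA x y, hconst y hy hyK x hxK, hconst y hy hyK z hzK]
        exact ⟨hPQ x hxK z hzK hxy hyz, hPQ x hxK z hzK hxy hyz⟩
      · rw [a2 _ hyK _ hzK] at hyz
        rw [hA x z, hA x y, hconst z hz hzK x hxK, hconst y hy hyK x hxK]
        exact ⟨le_rfl, hMM' y hy hyK z hz hzK hyz⟩
      · rw [a3 _ hxK _ hyK] at hxy
        rw [a1 _ hyK _ hzK] at hyz
        rw [hconst x hx hxK z hzK, hconst x hx hxK y hyK]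
        exact ⟨le_rfl, hQ y hyK z hzK hyz hxy⟩
      · rw [a3 _ hxK _ hyK] at hxy
        rw [a4 _ hzK _ hyK] at hyz
        omega
      · rw [a2 _ hxK _ hyK] at hxy
        rw [hconst x hx hxK z hzK, hconst y hy hyK z hzK]
        exact ⟨hMM' x hx hxK y hy hyK hxy, le_rfl⟩
      · rw [a2 _ hxK _ hyK] at hxy
        rw [a2 _ hyK _ hzK] at hyz
        exact hf.2 x hx y hy z hz hxy hyz
    · intro x hx
      by_cases hxK : x ∈ K
      · have := a1 b hb x hxK
        have := hbr x hxK
        omega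
      · exact ((a3 x hxK b hb).2 hlb).le

theorem anchor_of_last {V : Type*} [Fintype V] [DecidableEq V] {A : V → V → ℝ}
    (hA : ∀ x y, A x y = A y x) (s : V → ℤ) (m : ℕ) :
    ∀ (S : Finset V) (f : V → ℤ) (b : V), S.card = m → Rob A S f → SFS A S s → b ∈ S →
      (∀ x ∈ S, s x ≤ s b) → ∃ F : V → ℤ, Rob A S F ∧ ∀ x ∈ S, F x ≤ F b := by
  induction m using Nat.strong_induction_on with
  | _ m ih =>
    intro S f b hm hf hs hb hbs
    obtain ⟨p, hp, hpmin⟩ := Finset.exists_min_image S s ⟨b, hb⟩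
    by_cases hpb : b = p
    · refine ⟨f, hf, fun x hx => ?_⟩
      have h1 := hpmin x hx
      have h2 := hbs x hx
      rw [← hpb] at h1
      rw [hs.1 hx hb (by omega)]
    · obtain ⟨K, hKS, hbK, hpK, hside, hom⟩ := exists_shrink hA hf hs hp hb hpb hpmin hbs
      have hcard : K.card < m := by
        rw [← hm]
        apply Finset.card_lt_card
        rw [Finset.ssubset_iff_of_subset hKS]
        exact ⟨p, hp, hpK⟩
      obtain ⟨r, hr, hrb⟩ := ih K.card hcard K f b rfl
        ⟨hf.1.mono (by exact_mod_cast hKS), fun x hx y hy z hz =>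
          hf.2 x (hKS hx) y (hKS hy) z (hKS hz)⟩ (hs.restrict hKS hom) hbK
        (fun x hx => hbs x (hKS hx))
      rcases lt_or_gt_of_ne (fun h => hpb (hf.1 hb hp h)) with h | h
      · refine glue_main hA (hf.neg hA) hr hKS hom ?_ hp hpK hbK hrb (by simpa using h)
        intro k hk
        rcases hside k hk with h' | h'
        · right; intro x hx hxK; simpa using h' x hx hxK
        · left; intro x hx hxK; simpa using h' x hx hxK
      · exact glue_main hA hf hr hKS hom hside hp hpK hbK hrb h

theorem opposite {V : Type*} [Fintype V] [DecidableEq V] {A : V → V → ℝ}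
    (hA : ∀ x y, A x y = A y x) {s f : V → ℤ} {a b : V} (hf : Rob A Finset.univ f)
    (hs : SFS A Finset.univ s) (hsa : ∀ x, s a ≤ s x) (hsb : ∀ x, s x ≤ s b)
    (hfa : ∀ x, f a ≤ f x) :
    ∃ F : V → ℤ, Rob A Finset.univ F ∧ (∀ x, F a ≤ F x) ∧ ∀ x, F x ≤ F b := by
  by_cases hab : b = a
  · refine ⟨f, hf, hfa, fun x => ?_⟩
    have h1 := hsa x
    have h2 := hsb x
    rw [← hab] at h1
    rw [hs.1 (Finset.mem_univ x) (Finset.mem_univ b) (by omega)]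
  · obtain ⟨K, hKS, hbK, hpK, hside, hom⟩ := exists_shrink hA hf hs (Finset.mem_univ a)
      (Finset.mem_univ b) hab (fun x _ => hsa x) (fun x _ => hsb x)
    obtain ⟨r, hr, hrb⟩ := anchor_of_last hA s K.card K f b rfl
        ⟨hf.1.mono (by exact_mod_cast hKS), fun x hx y hy z hz =>
          hf.2 x (hKS hx) y (hKS hy) z (hKS hz)⟩ (hs.restrict hKS hom) hbK
        (fun x hx => hsb x)
    obtain ⟨F, hF, h2, h3, h4⟩ := glue_right hA hf hr hKS hom (by
      intro k hk
      rcases hside k hk with h | h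
      · have e1 := h a (Finset.mem_univ a) hpK
        have e2 := hfa k
        omega
      · exact h)
    refine ⟨F, hF, fun x => ?_, fun x => ?_⟩
    · by_cases hx : x ∈ K
      · exact (h2 a (Finset.mem_univ a) hpK x hx).le
      · have e1 := h4 x (Finset.mem_univ x) hx a (Finset.mem_univ a) hpK
        have e2 := hfa x
        omega
    · by_cases hx : x ∈ K
      · have e1 := h3 b hbK x hx
        have e2 := hrb x hx
        omega
      · exact (h2 x (Finset.mem_univ x) hx b hbK).le

theorem rob_of_perm {n : ℕ} {A : Matrix (Fin n) (Fin n) ℝ} {π : Equiv.Perm (Fin n)}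
    (h : IsRobinsonOrdering A π) : Rob A Finset.univ (fun x => ((π x : ℕ) : ℤ)) := by
  refine ⟨?_, ?_⟩
  · intro x _ y _ hxy
    apply π.injective
    apply Fin.ext
    simpa using hxy
  · intro x _ y _ z _ h1 h2
    have := h x y z (by simpa using h1) (by simpa using h2)
    exact le_min_iff.1 this

theorem sfs_of_perm {n : ℕ} {A : Matrix (Fin n) (Fin n) ℝ} {σ : Equiv.Perm (Fin n)}
    (h : IsSFSOrdering A σ) : SFS A Finset.univ (fun x => ((σ x : ℕ) : ℤ)) := by
  refine ⟨?_, ?_⟩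
  · intro x _ y _ hxy
    apply σ.injective
    apply Fin.ext
    simpa using hxy
  · intro x _ y _ z _ h1 h2 h3
    obtain ⟨u, hu, hlt⟩ := h x y z (by simpa using h1) (by simpa using h2) h3
    exact ⟨u, Finset.mem_univ u, by simpa using hu, hlt⟩

theorem exists_perm {n : ℕ} (F : Fin n → ℤ) (hF : Function.Injective F) :
    ∃ π : Equiv.Perm (Fin n), ∀ x y, π x < π y ↔ F x < F y := by
  refine ⟨(Tuple.sort F)⁻¹, ?_⟩
  have hm : StrictMono (F ∘ Tuple.sort F) :=
    (Tuple.monotone_sort F).strictMono_of_injective (hF.comp (Tuple.sort F).injective)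
  intro x y
  have := hm.lt_iff_lt (a := (Tuple.sort F)⁻¹ x) (b := (Tuple.sort F)⁻¹ y)
  simpa using this.symm

end SFSProof

/-- If `σ` is a good SFS ordering of a symmetric Robinsonian matrix `A`
with first vertex `a` and last vertex `b`, then `a` and `b` are opposite anchors of `A`. -/
theorem stmt_8 {n : ℕ} (A : Matrix (Fin n) (Fin n) ℝ) (hA : A.IsSymm)
    (hRob : IsRobinsonian A)
    (σ : Equiv.Perm (Fin n)) (hσ : IsGoodSFS A σ)
    (a b : Fin n) (ha : IsFirstOf σ a) (hb : IsLastOf σ b) :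
    OppositeAnchors A a b := by

  have hA' : ∀ x y, A x y = A y x := fun x y => hA.apply y x
  obtain ⟨hs, a', ha', τ, hτ, hlast⟩ := hσ
  have haa : a' = a := σ.injective (le_antisymm (ha' a) (ha a'))
  subst haa
  obtain ⟨π, hπ⟩ := hRob
  obtain ⟨G, hG, hGa⟩ := SFSProof.anchor_of_last (A := A) hA' _ _ Finset.univ _ a' rfl
    (SFSProof.rob_of_perm hπ) (SFSProof.sfs_of_perm hτ) (Finset.mem_univ a')
    (fun x _ => by simpa using hlast x)
  obtain ⟨F, hF, hFa, hFb⟩ := SFSProof.opposite (A := A) hA' (hG.neg hA')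
    (SFSProof.sfs_of_perm hs) (a := a') (b := b) (fun x => by simpa using ha x)
    (fun x => by simpa using hb x) (fun x => by simpa using hGa x (Finset.mem_univ x))
  obtain ⟨ρ, hρ⟩ := SFSProof.exists_perm F
    (fun x y h => hF.1 (Finset.mem_univ x) (Finset.mem_univ y) h)
  refine ⟨ρ, ?_, ?_, ?_⟩
  · intro x y z h1 h2
    exact le_min_iff.2 (hF.2 x (Finset.mem_univ x) y (Finset.mem_univ y) z (Finset.mem_univ z)
      ((hρ x y).1 h1) ((hρ y z).1 h2))
  · intro y
    rw [← not_lt, hρ]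
    exact not_lt.2 (hFa y)
  · intro y
    rw [← not_lt, hρ]
    exact not_lt.2 (hFb y)
end

section
/- (Anchors flipping property) Let A be a symmetric n×n real matrix that is Robinsonian, let σ be a good SFS ordering of A that starts with a and ends with b, and let σ_+ be an SFS_+ ordering of A with respect to σ. Then σ_+ starts with b and ends with a. -/
namespace Flip

variable {n : ℕ}

theorem exists_first (τ : Equiv.Perm (Fin n)) (Q : Fin n → Prop) (h : ∃ x, Q x) :
    ∃ x, Q x ∧ ∀ y, τ y < τ x → ¬ Q y := by
  obtain ⟨x, hx, hm⟩ := (InvImage.wf τ (wellFounded_lt (α := Fin n))).has_min {x | Q x} h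
  exact ⟨x, hx, fun y hy hq => hm y hq hy⟩

theorem first_dist {A : Matrix (Fin n) (Fin n) ℝ} {τ : Equiv.Perm (Fin n)}
    (hS : IsSFSOrdering A τ) {p q : Fin n} (hpq : τ p < τ q)
    (h : ∃ u, τ u < τ p ∧ A u p ≠ A u q) :
    ∃ u, τ u < τ p ∧ A u q < A u p ∧ ∀ v, τ v < τ u → A v p = A v q := by
  obtain ⟨u, ⟨hu, hne⟩, hm⟩ := exists_first τ _ h
  have hm' : ∀ v, τ v < τ u → A v p = A v q := by
    intro v hv
    by_contra hc
    exact hm v hv ⟨hv.trans hu, hc⟩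
  refine ⟨u, hu, ?_, hm'⟩
  rcases lt_or_gt_of_ne hne with h1 | h1
  · obtain ⟨v, hv, hlt⟩ := hS u p q hu hpq h1
    exact absurd (hm' v hv) (ne_of_gt hlt)
  · exact h1

structure RO (A : Matrix (Fin n) (Fin n) ℝ) (R : Fin n → Fin n → Prop) : Prop where
  irr : ∀ x, ¬ R x x
  tr : ∀ x y z, R x y → R y z → R x z
  tri : ∀ x y, R x y ∨ x = y ∨ R y x
  r1 : ∀ x y z, R x y → R y z → A x z ≤ A x y
  r2 : ∀ x y z, R x y → R y z → A x z ≤ A y z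

theorem RO.flip {A : Matrix (Fin n) (Fin n) ℝ} (hA : ∀ x y, A x y = A y x)
    {R : Fin n → Fin n → Prop} (h : RO A R) : RO A (fun x y => R y x) where
  irr := h.irr
  tr := fun x y z h1 h2 => h.tr _ _ _ h2 h1
  tri := fun x y => by rcases h.tri x y with h | h | h <;> simp [h]
  r1 := fun x y z h1 h2 => by rw [hA x z, hA x y]; exact h.r2 _ _ _ h2 h1
  r2 := fun x y z h1 h2 => by rw [hA x z, hA y z]; exact h.r1 _ _ _ h2 h1

theorem no_state {A : Matrix (Fin n) (Fin n) ℝ} (hA : ∀ x y, A x y = A y x)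
    {R : Fin n → Fin n → Prop} (h : RO A R)
    {τ : Equiv.Perm (Fin n)} (hS : IsSFSOrdering A τ) (y : Fin n) :
    ∀ (k : ℕ) (p q s : Fin n), (τ p : ℕ) = k → τ p < τ q → τ q < τ s → τ p < τ y →
      A p q < A p s → (R p y ∧ R y q ∨ R q y ∧ R y p) →
      (∀ u, τ u < τ p → A u s = A u y) → False := by
  intro k
  induction k using Nat.strong_induction_on with
  | _ k ih =>
    intro p q s hk hpq hqs hpy hlt hside hc
    obtain ⟨u0, hu0, hu0'⟩ := hS p q s hpq hqs hlt
    obtain ⟨u, hu, hult, hum⟩ := first_dist hS hqs ⟨u0, hu0.trans hpq, ne_of_gt hu0'⟩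
    have hup : τ u < τ p := by
      by_contra hcon
      have : τ u0 < τ u := lt_of_lt_of_le hu0 (not_lt.mp hcon)
      exact absurd (hum u0 this) (ne_of_gt hu0')
    have hus := hc u hup
    have huy : u ≠ y := by rintro rfl; exact absurd (hup.trans hpy) (lt_irrefl _)
    have key : A u p < A u q ∧ (R u y ∧ R y p ∨ R p y ∧ R y u) := by
      rcases hside with ⟨h1, h2⟩ | ⟨h1, h2⟩
      · rcases h.tri u y with h3 | h3 | h3
        · have := h.r1 _ _ _ h3 h2
          linarith
        · exact absurd h3 huy
        · have := h.r2 _ _ _ h1 h3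
          rw [hA p u, hA y u] at this
          exact ⟨by linarith, Or.inr ⟨h1, h3⟩⟩
      · rcases h.tri u y with h3 | h3 | h3
        · have := h.r1 _ _ _ h3 h2
          exact ⟨by linarith, Or.inl ⟨h3, h2⟩⟩
        · exact absurd h3 huy
        · have := h.r2 _ _ _ h1 h3
          rw [hA q u, hA y u] at this
          linarith
    refine ih (τ u) (by rw [← hk]; exact hup) u p q rfl hup hpq (hup.trans hpy) key.1 key.2 ?_
    intro v hv
    rw [hum v hv, hc v (hv.trans hup)]

theorem lemA {A : Matrix (Fin n) (Fin n) ℝ} (hA : ∀ x y, A x y = A y x)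
    {R : Fin n → Fin n → Prop} (h : RO A R)
    {τ : Equiv.Perm (Fin n)} (hS : IsSFSOrdering A τ) {x y r : Fin n}
    (h1 : R x y) (h2 : R y r) (t1 : τ x < τ r) (t2 : τ r < τ y) : A x y ≤ A x r := by
  by_contra hc
  exact no_state hA h hS y _ x r y rfl t1 t2 (t1.trans t2) (not_le.mp hc) (Or.inl ⟨h1, h2⟩)
    (fun _ _ => rfl)

/-- monotone edges towards `a` avoiding `r` -/
def E (A : Matrix (Fin n) (Fin n) ℝ) (R : Fin n → Fin n → Prop) (a r x y : Fin n) : Prop :=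
  R x y ∧ (y = a ∨ R y a) ∧ A x r < A x y

theorem no_path {A : Matrix (Fin n) (Fin n) ℝ} (hA : ∀ x y, A x y = A y x)
    {R : Fin n → Fin n → Prop} (h : RO A R)
    {τ : Equiv.Perm (Fin n)} (hS : IsSFSOrdering A τ) {a l r : Fin n} (ha : IsLastOf τ a)
    (hr : R a r) (hlr : τ l < τ r) (hp : Relation.ReflTransGen (E A R a r) l a) : False := by
  have key : ∀ x, Relation.ReflTransGen (E A R a r) l x → τ x < τ r := by
    intro x hx
    induction hx with
    | refl => exact hlr
    | @tail x y _ hxy ih =>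
      obtain ⟨e1, e2, e3⟩ := hxy
      have hyr : R y r := by
        rcases e2 with rfl | e2
        · exact hr
        · exact h.tr _ _ _ e2 hr
      by_contra hc
      rcases lt_or_eq_of_le (not_lt.mp hc) with hc | hc
      · have := lemA hA h hS e1 hyr ih hc
        linarith
      · have := τ.injective hc
        subst this
        exact h.irr _ hyr
  exact absurd (key a hp) (not_lt.mpr (ha r))

theorem valid {A : Matrix (Fin n) (Fin n) ℝ} (hA : ∀ x y, A x y = A y x)
    {R : Fin n → Fin n → Prop} (h : RO A R)
    {τ : Equiv.Perm (Fin n)} (hS : IsSFSOrdering A τ) {a l r : Fin n} (ha : IsLastOf τ a)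
    (hl : R l a) (hr : R a r)
    (hp : Relation.ReflTransGen (E A R a r) l a)
    (hq : Relation.ReflTransGen (E A (fun x y => R y x) a l) r a) : False := by
  rcases lt_trichotomy (τ l) (τ r) with h1 | h1 | h1
  · exact no_path hA h hS ha hr h1 hp
  · have := τ.injective h1
    subst this
    exact h.irr _ (h.tr _ _ _ hl hr)
  · exact no_path hA (h.flip hA) hS ha hl h1 hq

def P (A : Matrix (Fin n) (Fin n) ℝ) (R : Fin n → Fin n → Prop) (a r l : Fin n) : Prop :=
  ∃ l0 r0, (l0 = l ∨ R l0 l) ∧ (r0 = r ∨ R r r0) ∧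
    Relation.ReflTransGen (E A R a r0) l0 a ∧
    Relation.ReflTransGen (E A (fun x y => R y x) a l0) r0 r

/-- weakening the avoided vertex to a farther one -/
theorem E_mono {A : Matrix (Fin n) (Fin n) ℝ}
    {R : Fin n → Fin n → Prop} (h : RO A R) {a r r' x y : Fin n}
    (hr : R a r) (hrr : R r r') (hE : Relation.ReflTransGen (E A R a r) x y) :
    Relation.ReflTransGen (E A R a r') x y := by
  refine Relation.ReflTransGen.mono (r := E A R a r) ?_ _ _ hE
  rintro x y ⟨e1, e2, e3⟩
  refine ⟨e1, e2, lt_of_le_of_lt (h.r1 x r r' ?_ hrr) e3⟩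
  rcases e2 with rfl | e2
  · exact h.tr _ _ _ e1 hr
  · exact h.tr _ _ _ e1 (h.tr _ _ _ e2 hr)

theorem E_cross {A : Matrix (Fin n) (Fin n) ℝ}
    {R : Fin n → Fin n → Prop} (h : RO A R) {a r x y z : Fin n}
    (hE : Relation.ReflTransGen (E A R a r) x y) (hxz : x = z ∨ R x z) (hzy : R z y) :
    Relation.ReflTransGen (E A R a r) x z := by
  induction hE with
  | refl =>
    rcases hxz with rfl | hxz
    · exact .refl
    · exact absurd (h.tr _ _ _ hxz hzy) (h.irr _)
  | @tail p q hp hpq ih =>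
    rcases h.tri z p with h1 | h1 | h1
    · exact ih h1
    · subst h1; exact hp
    · obtain ⟨e1, e2, e3⟩ := hpq
      refine hp.tail ⟨h1, ?_, lt_of_lt_of_le e3 (h.r1 _ _ _ h1 hzy)⟩
      rcases e2 with rfl | e2
      · exact Or.inr hzy
      · exact Or.inr (h.tr _ _ _ hzy e2)

theorem P_base {A : Matrix (Fin n) (Fin n) ℝ} {R : Fin n → Fin n → Prop} {a l r : Fin n}
    (hl : R l a) (hlt : A l r < A l a) : P A R a r l :=
  ⟨l, r, Or.inl rfl, Or.inl rfl, .single ⟨hl, Or.inl rfl, hlt⟩, .refl⟩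

theorem P_up1 {A : Matrix (Fin n) (Fin n) ℝ} {R : Fin n → Fin n → Prop} (h : RO A R)
    {a l l' r : Fin n} (hP : P A R a r l) (hl : R l l') : P A R a r l' := by
  obtain ⟨l0, r0, h1, h2, h3, h4⟩ := hP
  refine ⟨l0, r0, Or.inr ?_, h2, h3, h4⟩
  rcases h1 with rfl | h1
  · exact hl
  · exact h.tr _ _ _ h1 hl

theorem P_up2 {A : Matrix (Fin n) (Fin n) ℝ} (hA : ∀ x y, A x y = A y x)
    {R : Fin n → Fin n → Prop} (h : RO A R)
    {a l r r' : Fin n} (hP : P A R a r l) (har : R a r) (hr : R r r') : P A R a r' l := by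
  obtain ⟨l0, r0, h1, h2, h3, h4⟩ := hP
  rcases h.tri r0 r' with hc | hc | hc
  · have har0 : R a r0 := by
      rcases h2 with rfl | h2
      · exact har
      · exact h.tr _ _ _ har h2
    exact ⟨l0, r', h1, Or.inl rfl, E_mono h har0 hc h3, .refl⟩
  · subst hc
    exact ⟨l0, r0, h1, Or.inl rfl, h3, .refl⟩
  · exact ⟨l0, r0, h1, Or.inr hc, h3, E_cross (h.flip hA) h4 (Or.inr hc) hr⟩

theorem P_stepL {A : Matrix (Fin n) (Fin n) ℝ} (hA : ∀ x y, A x y = A y x)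
    {R : Fin n → Fin n → Prop} (h : RO A R)
    {a l l' r : Fin n} (hP : P A R a r l') (har : R a r) (hll : R l l') (hl : R l' a)
    (hlt : A l r < A l l') : P A R a r l := by
  obtain ⟨l0, r0, h1, h2, h3, h4⟩ := hP
  rcases h.tri l0 l with hc | hc | hc
  · exact ⟨l0, r0, Or.inr hc, h2, h3, h4⟩
  · exact ⟨l0, r0, Or.inl hc, h2, h3, h4⟩
  · have hl0 : R l0 a := by
      rcases h1 with rfl | h1
      · exact hl
      · exact h.tr _ _ _ h1 hl
    have i1 : A l l' ≤ A l l0 := by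
      rcases h1 with rfl | h1
      · exact le_rfl
      · exact h.r1 _ _ _ hc h1
    have i2 : A l r0 ≤ A l r := by
      rcases h2 with rfl | h2
      · exact le_rfl
      · exact h.r1 _ _ _ (h.tr _ _ _ (h.tr _ _ _ hll hl) har) h2
    refine ⟨l, r0, Or.inl rfl, h2, h3.head ⟨hc, Or.inr hl0, by linarith⟩, ?_⟩
    exact E_mono (h.flip hA) hl0 hc h4

theorem P_stepR {A : Matrix (Fin n) (Fin n) ℝ} (hA : ∀ x y, A x y = A y x)
    {R : Fin n → Fin n → Prop} (h : RO A R)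
    {a l r r' : Fin n} (hP : P A R a r l) (har : R a r') (hrr : R r' r) (hl : R l a)
    (hlt : A r l < A r r') : P A R a r' l := by
  obtain ⟨l0, r0, h1, h2, h3, h4⟩ := hP
  have i1 : A r l0 ≤ A r l := by
    rcases h1 with rfl | h1
    · exact le_rfl
    · rw [hA r l0, hA r l]
      exact h.r2 _ _ _ h1 (h.tr _ _ _ hl (h.tr _ _ _ har hrr))
  refine ⟨l0, r0, h1, Or.inr ?_, h3, h4.tail ⟨hrr, Or.inr har, by linarith⟩⟩
  rcases h2 with rfl | h2
  · exact hrr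
  · exact h.tr _ _ _ hrr h2

theorem P_fin {A : Matrix (Fin n) (Fin n) ℝ} (hA : ∀ x y, A x y = A y x)
    {R : Fin n → Fin n → Prop} (h : RO A R)
    {τ : Equiv.Perm (Fin n)} (hS : IsSFSOrdering A τ) {a l r : Fin n} (ha : IsLastOf τ a)
    (hP : P A R a r l) (har : R a r) (hl : R l a) : A r a ≤ A r l := by
  obtain ⟨l0, r0, h1, h2, h3, h4⟩ := hP
  by_contra hc
  have i1 : A r l0 ≤ A r l := by
    rcases h1 with rfl | h1
    · exact le_rfl
    · rw [hA r l0, hA r l]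
      exact h.r2 _ _ _ h1 (h.tr _ _ _ hl har)
  have hl0 : R l0 a := by
    rcases h1 with rfl | h1
    · exact hl
    · exact h.tr _ _ _ h1 hl
  have hr0 : R a r0 := by
    rcases h2 with rfl | h2
    · exact har
    · exact h.tr _ _ _ har h2
  exact valid hA h hS ha hl0 hr0 h3 (h4.tail ⟨har, Or.inl rfl, by linarith⟩)

/-- the merged order, ending with `a` -/
def N (A : Matrix (Fin n) (Fin n) ℝ) (R : Fin n → Fin n → Prop) (a x y : Fin n) : Prop :=
  (R x a ∧ R y a ∧ R x y) ∨ (R a x ∧ R a y ∧ R y x) ∨ (x ≠ a ∧ y = a) ∨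
  (R x a ∧ R a y ∧ ¬ P A R a y x) ∨ (R a x ∧ R y a ∧ P A R a x y)

theorem N_RO {A : Matrix (Fin n) (Fin n) ℝ} (hA : ∀ x y, A x y = A y x)
    {R : Fin n → Fin n → Prop} (h : RO A R)
    {τ : Equiv.Perm (Fin n)} (hS : IsSFSOrdering A τ) {a : Fin n} (ha : IsLastOf τ a) :
    RO A (N A R a) := by
  have sL : ∀ x, R x a → ¬ R a x ∧ x ≠ a := by
    intro x hx
    refine ⟨fun h2 => h.irr _ (h.tr _ _ _ hx h2), ?_⟩
    rintro rfl; exact h.irr _ hx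
  have sR : ∀ x, R a x → ¬ R x a ∧ x ≠ a := by
    intro x hx
    refine ⟨fun h2 => h.irr _ (h.tr _ _ _ hx h2), ?_⟩
    rintro rfl; exact h.irr _ hx
  have LL : ∀ x y, R x a → R y a → (N A R a x y ↔ R x y) := by
    intro x y hx hy
    simp [N, hx, hy, sL x hx, sL y hy]
  have RR : ∀ x y, R a x → R a y → (N A R a x y ↔ R y x) := by
    intro x y hx hy
    simp [N, hx, hy, sR x hx, sR y hy]
  have LR : ∀ x y, R x a → R a y → (N A R a x y ↔ ¬ P A R a y x) := by
    intro x y hx hy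
    simp [N, hx, hy, sL x hx, sR y hy]
  have RL : ∀ x y, R a x → R y a → (N A R a x y ↔ P A R a x y) := by
    intro x y hx hy
    simp [N, hx, hy, sR x hx, sL y hy]
  have XA : ∀ x, N A R a x a ↔ x ≠ a := by
    intro x
    simp [N, h.irr a]
  have AX : ∀ x, ¬ N A R a a x := by
    intro x
    simp [N, h.irr a]
  have up1 := fun (l l' r : Fin n) => P_up1 h (a := a) (l := l) (l' := l') (r := r)
  have up2 := fun (l r r' : Fin n) => P_up2 hA h (a := a) (l := l) (r := r) (r' := r')
  have tr : ∀ x y z, N A R a x y → N A R a y z → N A R a x z := by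
    intro x y z h1 h2
    have hxa : x ≠ a := by rintro rfl; exact AX _ h1
    have hya : y ≠ a := by rintro rfl; exact AX _ h2
    rcases h.tri z a with hz | hz | hz
    rotate_left
    · subst hz; exact (XA x).2 hxa
    · rcases h.tri x a with hx | hx | hx
      · rcases h.tri y a with hy | hy | hy
        · rw [LL _ _ hx hy] at h1
          rw [LR _ _ hy hz] at h2
          rw [LR _ _ hx hz]
          exact fun hp => h2 (up1 _ _ _ hp h1)
        · exact absurd hy hya
        · rw [LR _ _ hx hy] at h1
          rw [RR _ _ hy hz] at h2
          rw [LR _ _ hx hz]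
          exact fun hp => h1 (up2 _ _ _ hp hz h2)
      · exact absurd hx hxa
      · rcases h.tri y a with hy | hy | hy
        · rw [RL _ _ hx hy] at h1
          rw [LR _ _ hy hz] at h2
          rw [RR _ _ hx hz]
          rcases h.tri z x with h3 | h3 | h3
          · exact h3
          · subst h3; exact absurd h1 h2
          · exact absurd (up2 _ _ _ h1 hx h3) h2
        · exact absurd hy hya
        · rw [RR _ _ hx hy] at h1
          rw [RR _ _ hy hz] at h2
          rw [RR _ _ hx hz]
          exact h.tr _ _ _ h2 h1
    · rcases h.tri x a with hx | hx | hx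
      · rcases h.tri y a with hy | hy | hy
        · rw [LL _ _ hx hy] at h1
          rw [LL _ _ hy hz] at h2
          rw [LL _ _ hx hz]
          exact h.tr _ _ _ h1 h2
        · exact absurd hy hya
        · rw [LR _ _ hx hy] at h1
          rw [RL _ _ hy hz] at h2
          rw [LL _ _ hx hz]
          rcases h.tri x z with h3 | h3 | h3
          · exact h3
          · subst h3; exact absurd h2 h1
          · exact absurd (up1 _ _ _ h2 h3) h1
      · exact absurd hx hxa
      · rcases h.tri y a with hy | hy | hy
        · rw [RL _ _ hx hy] at h1
          rw [LL _ _ hy hz] at h2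
          rw [RL _ _ hx hz]
          exact up1 _ _ _ h1 h2
        · exact absurd hy hya
        · rw [RR _ _ hx hy] at h1
          rw [RL _ _ hy hz] at h2
          rw [RL _ _ hx hz]
          exact up2 _ _ _ h2 hy h1
  have rob : ∀ x y z, N A R a x y → N A R a y z → A x z ≤ A x y ∧ A x z ≤ A y z := by
    intro x y z h1 h2
    rcases h.tri x a with hx | hx | hx
    · rcases h.tri y a with hy | hy | hy
      · rw [LL _ _ hx hy] at h1
        rcases h.tri z a with hz | hz | hz
        · rw [LL _ _ hy hz] at h2
          exact ⟨h.r1 _ _ _ h1 h2, h.r2 _ _ _ h1 h2⟩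
        · subst hz
          exact ⟨h.r1 _ _ _ h1 hy, h.r2 _ _ _ h1 hy⟩
        · have h2 := h.tr _ _ _ hy hz
          exact ⟨h.r1 _ _ _ h1 h2, h.r2 _ _ _ h1 h2⟩
      · subst hy; exact absurd h2 (AX z)
      · rw [LR _ _ hx hy] at h1
        rcases h.tri z a with hz | hz | hz
        · rw [RL _ _ hy hz] at h2
          have hxz : R x z := by
            have := tr x y z ((LR _ _ hx hy).2 h1) ((RL _ _ hy hz).2 h2)
            rwa [LL _ _ hx hz] at this
          have k1 : A x z ≤ A x y := by
            by_contra hc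
            exact h1 (P_stepL hA h h2 hy hxz hz (not_le.mp hc))
          have k2 := h.r2 _ _ _ hxz (h.tr _ _ _ hz hy)
          rw [hA z y] at k2
          exact ⟨k1, k1.trans k2⟩
        · subst hz
          have k1 : A x z ≤ A x y := by
            by_contra hc
            exact h1 (P_base hx (not_le.mp hc))
          have k2 := h.r2 _ _ _ hx hy
          rw [hA z y] at k2
          exact ⟨k1, k1.trans k2⟩
        · rw [RR _ _ hy hz] at h2
          have k := h.tr _ _ _ hx hz
          have k3 := h.r1 _ _ _ hx hz
          have k4 := h.r2 _ _ _ k h2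
          rw [hA z y] at k4
          have k1 : A x z ≤ A x y := by
            by_contra hc
            exact h1 (P_base hx (by linarith))
          exact ⟨k1, k1.trans k4⟩
    · subst hx; exact absurd h1 (AX y)
    · rcases h.tri y a with hy | hy | hy
      · rw [RL _ _ hx hy] at h1
        have f := P_fin hA h hS ha h1 hx hy
        rcases h.tri z a with hz | hz | hz
        · rw [LL _ _ hy hz] at h2
          have k1 := h.r2 _ _ _ hz hx
          have k2 := h.r1 _ _ _ h2 (h.tr _ _ _ hz hx)
          rw [hA z x, hA a x] at k1
          rw [hA y x] at k2
          constructor <;> linarith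
        · subst hz
          have k2 := h.r1 _ _ _ hy hx
          rw [hA y x] at k2
          constructor <;> linarith
        · have hzx : R z x := by
            have := tr x y z ((RL _ _ hx hy).2 h1) h2
            rwa [RR _ _ hx hz] at this
          rw [LR _ _ hy hz] at h2
          have k1 : A x z ≤ A x y := by
            by_contra hc
            exact h2 (P_stepR hA h h1 hz hzx hy (not_le.mp hc))
          have k2 := h.r1 _ _ _ (h.tr _ _ _ hy hz) hzx
          rw [hA y x] at k2
          constructor <;> linarith
      · subst hy; exact absurd h2 (AX z)
      · rw [RR _ _ hx hy] at h1
        have hzy : R z y := by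
          rcases h.tri z a with hz | hz | hz
          · exact h.tr _ _ _ hz hy
          · subst hz; exact hy
          · rwa [RR _ _ hy hz] at h2
        have k1 := h.r1 _ _ _ hzy h1
        have k2 := h.r2 _ _ _ hzy h1
        rw [hA x z, hA x y, hA y z]
        exact ⟨k2, k1⟩
  refine ⟨?_, tr, ?_, fun x y z h1 h2 => (rob x y z h1 h2).1,
    fun x y z h1 h2 => (rob x y z h1 h2).2⟩
  · intro x
    rcases h.tri x a with hx | hx | hx
    · rw [LL _ _ hx hx]; exact h.irr _
    · subst hx; exact AX _
    · rw [RR _ _ hx hx]; exact h.irr _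
  · intro x y
    rcases h.tri x a with hx | hx | hx <;> rcases h.tri y a with hy | hy | hy
    · rw [LL _ _ hx hy, LL _ _ hy hx]; exact h.tri x y
    · subst hy; left; rw [XA]; rintro rfl; exact h.irr _ hx
    · rw [LR _ _ hx hy, RL _ _ hy hx]; tauto
    · subst hx; right; right; rw [XA]; rintro rfl; exact h.irr _ hy
    · subst hx; exact Or.inr (Or.inl hy.symm)
    · subst hx; right; right; rw [XA]; rintro rfl; exact h.irr _ hy
    · rw [RL _ _ hx hy, LR _ _ hy hx]; tauto
    · subst hy; left; rw [XA]; rintro rfl; exact h.irr _ hx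
    · rw [RR _ _ hx hy, RR _ _ hy hx]; have := h.tri x y; tauto

theorem flip_last {A : Matrix (Fin n) (Fin n) ℝ} (hA : ∀ x y, A x y = A y x)
    {R : Fin n → Fin n → Prop} (h : RO A R) {a : Fin n} (hRa : ∀ x, x ≠ a → R a x)
    {σ ρ : Equiv.Perm (Fin n)} (hS : IsSFSOrdering A σ) (ha : IsFirstOf σ a)
    (hρ : IsSFSPlus A σ ρ) : IsLastOf ρ a := by
  obtain ⟨c, -, hc⟩ := exists_first (ρ.trans Fin.revPerm) (fun _ => True) ⟨a, trivial⟩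
  have hcl : ∀ x, ρ x ≤ ρ c := by
    intro x
    by_contra hx
    refine hc x ?_ trivial
    simpa using hx
  by_cases hca : c = a
  · subst hca; exact hcl
  exfalso
  have lastlt : ∀ x, x ≠ c → ρ x < ρ c := fun x hx =>
    lt_of_le_of_ne (hcl x) (fun e => hx (ρ.injective e))
  have firstlt : ∀ x, x ≠ a → σ a < σ x := fun x hx =>
    lt_of_le_of_ne (ha x) (fun e => hx (ρ.injective (by rw [σ.injective e])))
  have hac : R a c := hRa c hca
  have hρac : ρ a < ρ c := lastlt a (Ne.symm hca)
  -- the first vertex distinguishing a and c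
  obtain ⟨u, hua, hult, hum⟩ : ∃ u, ρ u < ρ a ∧ A u c < A u a ∧
      ∀ v, ρ v < ρ u → A v a = A v c := by
    apply first_dist hρ.1 hρac
    by_contra hcon
    push Not at hcon
    exact absurd (hρ.2 a c hρac hcon) (not_lt.mpr (ha c))
  have hune : u ≠ a := by rintro rfl; exact absurd hua (lt_irrefl _)
  have hau : R a u := hRa u hune
  have huc : R u c := by
    rcases h.tri u c with h1 | h1 | h1
    · exact h1
    · subst h1; exact absurd (hua.trans hρac) (lt_irrefl _)
    · have := h.r2 _ _ _ hac h1
      rw [hA a u, hA c u] at this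
      linarith
  obtain ⟨w, ⟨haw, hwc⟩, hwm⟩ := exists_first ρ (fun x => R a x ∧ R x c) ⟨u, hau, huc⟩
  have hwu : ρ w ≤ ρ u := by
    by_contra hcon
    exact hwm u (not_le.mp hcon) ⟨hau, huc⟩
  have hwc' : w ≠ c := by rintro rfl; exact h.irr _ hwc
  -- ties at the time w is chosen
  have hcw : σ c < σ w := by
    apply hρ.2 w c (lastlt w hwc')
    intro v hv
    have hva : v ≠ a := by
      rintro rfl; exact absurd (hv.trans_le hwu) (not_lt.mpr hua.le)
    have hcv : R c v := by
      rcases h.tri c v with h1 | h1 | h1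
      · exact h1
      · subst h1; exact absurd hv (not_lt.mpr (hcl _))
      · exact absurd ⟨hRa v hva, h1⟩ (hwm v hv)
    have e := hum v (hv.trans_le hwu)
    have k1 := h.r2 _ _ _ haw (h.tr _ _ _ hwc hcv)
    have k2 := h.r2 _ _ _ hwc hcv
    rw [hA a v, hA w v] at k1
    rw [hA w v, hA c v] at k2
    linarith
  have mono : ∀ x y, x ≠ a → σ x < σ y → A a y ≤ A a x := by
    intro x y hx hxy
    by_contra hcon
    obtain ⟨v, hv, -⟩ := hS a x y (firstlt x hx) hxy (not_le.mp hcon)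
    exact absurd hv (not_lt.mpr (ha v))
  have e1 : A a w = A a c := le_antisymm (mono c w hca hcw) (h.r1 _ _ _ haw hwc)
  have hauc : A a c ≤ A u c := h.r2 _ _ _ hau huc
  have huw : R u w := by
    rcases h.tri u w with h1 | h1 | h1
    · exact h1
    · subst h1
      rw [hA u a] at hult
      linarith
    · have := h.r1 _ _ _ haw h1
      rw [hA u a] at hult
      linarith
  have hwu' : ρ w < ρ u := lt_of_le_of_ne hwu (fun e => by
    have := ρ.injective e
    subst this
    exact h.irr _ huw)
  have e2 : A w c = A a c := by
    rw [← hum w hwu', hA w a, e1]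
  have e3 : ∀ x, R a x → R x w → A x c = A a c := by
    intro x h1 h2
    have k1 := h.r2 _ _ _ h1 (h.tr _ _ _ h2 hwc)
    have k2 := h.r2 _ _ _ h2 hwc
    linarith
  have hua_gt : A a c < A a u := by
    rw [hA a u]; linarith
  have huc_σ : σ u < σ c := by
    by_contra hcon
    have hne : σ c ≠ σ u := fun e => by
      have := σ.injective e
      subst this
      exact h.irr _ huc
    have := mono c u hca (lt_of_le_of_ne (not_lt.mp hcon) hne)
    linarith
  let G : Fin n → Fin n → Prop := fun x y => R x y ∧ R y w ∧ A a c < A x y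
  have Gprop : ∀ x, Relation.ReflTransGen G u x →
      (x = u ∨ R u x) ∧ R a x ∧ R x w ∧ σ x < σ c := by
    intro x hx
    induction hx with
    | refl => exact ⟨Or.inl rfl, hau, huw, huc_σ⟩
    | @tail x y _ hxy ih =>
      obtain ⟨g1, g2, g3⟩ := hxy
      obtain ⟨i0, i1, i2, i3⟩ := ih
      refine ⟨Or.inr ?_, h.tr _ _ _ i1 g1, g2, ?_⟩
      · rcases i0 with rfl | i0
        · exact g1
        · exact h.tr _ _ _ i0 g1
      · by_contra hcon
        have hyc : R y c := h.tr _ _ _ g2 hwc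
        have hne : σ c ≠ σ y := fun e => by
          have := σ.injective e
          subst this
          exact h.irr _ hyc
        have := lemA hA h hS g1 hyc i3 (lt_of_le_of_ne (not_lt.mp hcon) hne)
        rw [e3 x i1 i2] at this
        linarith
  have Gcross : ∀ x v, Relation.ReflTransGen G u x → (u = v ∨ R u v) → R v x →
      Relation.ReflTransGen G u v := by
    intro x v hx huv hvx
    induction hx with
    | refl =>
      rcases huv with rfl | huv
      · exact .refl
      · exact absurd (h.tr _ _ _ huv hvx) (h.irr _)
    | @tail p q hp hpq ih =>
      rcases h.tri v p with h1 | h1 | h1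
      · exact ih h1
      · subst h1; exact hp
      · obtain ⟨g1, g2, g3⟩ := hpq
        exact hp.tail ⟨h1, h.tr _ _ _ hvx g2, lt_of_lt_of_le g3 (h.r1 _ _ _ h1 hvx)⟩
  have main : ∀ (k : ℕ) (x : Fin n), (ρ x : ℕ) = k → ρ x ≤ ρ u →
      Relation.ReflTransGen G u x → False := by
    intro k
    induction k using Nat.strong_induction_on with
    | _ k ih =>
      intro x hk hxu hx
      obtain ⟨i0, i1, i2, i3⟩ := Gprop x hx
      have hxc : R x c := h.tr _ _ _ i2 hwc
      have hxc' : ρ x < ρ c := lastlt x (by rintro rfl; exact h.irr _ hxc)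
      obtain ⟨v, hvx, hvlt, -⟩ : ∃ v, ρ v < ρ x ∧ A v c < A v x ∧
          ∀ v', ρ v' < ρ v → A v' x = A v' c := by
        apply first_dist hρ.1 hxc'
        by_contra hcon
        push Not at hcon
        exact absurd (hρ.2 x c hxc' hcon) (not_lt.mpr i3.le)
      have hvu : ρ v < ρ u := hvx.trans_le hxu
      have ev := hum v hvu
      have hva : v ≠ a := by rintro rfl; exact absurd hvu (not_lt.mpr hua.le)
      have hav : R a v := hRa v hva
      have exw : A x w ≤ A a c := by
        rw [← e3 x i1 i2]
        exact lemA hA h hS i2 hwc i3 hcw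
      have hvw : R v w := by
        rcases h.tri v w with h1 | h1 | h1
        · exact h1
        · subst h1
          rw [hA v x] at hvlt
          linarith
        · exfalso
          have k1 := h.r1 _ _ _ i2 h1
          rw [hA v x] at hvlt
          rcases h.tri v c with h2 | h2 | h2
          · have := h.r2 _ _ _ hav h2
            linarith
          · subst h2; exact absurd (hvx.trans hxc') (lt_irrefl _)
          · have := h.r2 _ _ _ hxc h2
            rw [hA c v] at this
            linarith
      have evc := e3 v hav hvw
      have huv : u = v ∨ R u v := by
        rcases h.tri u v with h1 | h1 | h1
        · exact Or.inr h1
        · exact Or.inl h1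
        · have := h.r1 _ _ _ hav h1
          rw [hA v a] at ev
          linarith
      refine ih (ρ v) (by rw [← hk]; exact hvx) v rfl hvu.le ?_
      rcases h.tri v x with h1 | h1 | h1
      · exact Gcross x v hx huv h1
      · subst h1; exact absurd hvx (lt_irrefl _)
      · refine hx.tail ⟨h1, hvw, ?_⟩
        rw [hA x v]; linarith
  exact main _ u rfl le_rfl .refl

end Flip

/-- Anchors flipping property: If `σ` is a good SFS ordering of a
symmetric Robinsonian matrix `A` starting with `a` and ending with `b`, and `σ₊` is an
SFS₊ ordering of `A` with respect to `σ`, then `σ₊` starts with `b` and ends with `a`. -/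
theorem stmt_9 {n : ℕ} (A : Matrix (Fin n) (Fin n) ℝ) (hA : A.IsSymm)
    (hRob : IsRobinsonian A)
    (σ : Equiv.Perm (Fin n)) (hσ : IsGoodSFS A σ)
    (a b : Fin n) (ha : IsFirstOf σ a) (hb : IsLastOf σ b)
    (σp : Equiv.Perm (Fin n)) (hσp : IsSFSPlus A σ σp) :
    IsFirstOf σp b ∧ IsLastOf σp a := by
  have hA' : ∀ x y, A x y = A y x := fun x y => (hA.apply x y).symm
  obtain ⟨π, hπ⟩ := hRob
  obtain ⟨hS, a', ha', τ, hτ, hlast⟩ := hσ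
  have haa : a' = a := σ.injective (le_antisymm (ha' a) (ha a'))
  subst haa
  have hR : Flip.RO A (fun x y => π x < π y) :=
    { irr := fun x => lt_irrefl _
      tr := fun x y z h1 h2 => h1.trans h2
      tri := fun x y => by
        rcases lt_trichotomy (π x) (π y) with h | h | h
        · exact Or.inl h
        · exact Or.inr (Or.inl (π.injective h))
        · exact Or.inr (Or.inr h)
      r1 := fun x y z h1 h2 => (hπ x y z h1 h2).trans (min_le_left _ _)
      r2 := fun x y z h1 h2 => (hπ x y z h1 h2).trans (min_le_right _ _) }
  have hN := (Flip.N_RO hA' hR hτ hlast).flip hA'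
  constructor
  · obtain ⟨f, -, hf⟩ := Flip.exists_first σp (fun _ => True) ⟨b, trivial⟩
    have hf' : ∀ x, σp f ≤ σp x := fun x => not_lt.mp fun hx => hf x hx trivial
    by_cases hfb : f = b
    · subst hfb; exact hf'
    · exfalso
      have hlt : σp f < σp b := lt_of_le_of_ne (hf' b) (fun e => hfb (σp.injective e))
      exact absurd (hσp.2 f b hlt (fun u hu => absurd hu (not_lt.mpr (hf' u))))
        (not_lt.mpr (hb f))
  · refine Flip.flip_last hA' hN ?_ hS ha hσp
    intro x hx
    exact Or.inr (Or.inr (Or.inl ⟨hx, rfl⟩))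
end

section
/- Let A be a symmetric n×n real matrix, let τ be a Robinson ordering of A, and let σ be an SFS_+ ordering of A with respect to τ. Then σ equals the reverse of τ, i.e., σ = τ^{-1}. -/
/-- If `τ` is a Robinson ordering of the symmetric matrix `A` and `σ` is
an SFS₊ ordering of `A` with respect to `τ`, then `σ` is the reverse of `τ`. -/
theorem stmt_11 {n : ℕ} (A : Matrix (Fin n) (Fin n) ℝ) (hA : A.IsSymm)
    (τ : Equiv.Perm (Fin n)) (hτ : IsRobinsonOrdering A τ)
    (σ : Equiv.Perm (Fin n)) (hσ : IsSFSPlus A τ σ) :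
    ∀ x : Fin n, σ x = (τ x).rev := by
  obtain ⟨h1, h2⟩ := hσ
  have key : ∀ (k : ℕ) (y z : Fin n), (σ y : ℕ) = k → σ y < σ z → τ z < τ y := by
    intro k
    induction k using Nat.strong_induction_on with
    | _ k ih =>
      intro y z hk hyz
      by_contra hcon
      have hne : τ y ≠ τ z := by
        intro h
        rw [τ.injective h] at hyz
        exact lt_irrefl _ hyz
      have hlt : τ y < τ z := lt_of_le_of_ne (not_lt.mp hcon) hne
      have hle : ∀ u, σ u < σ y → A u y ≤ A u z := by
        intro u hu
        have hzu : τ z < τ u := ih (σ u) (by rw [← hk]; exact hu) u z rfl (hu.trans hyz)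
        have := (hτ y z u hlt hzu).trans (min_le_right _ _)
        rwa [hA.apply u y, hA.apply u z] at this
      refine hcon (h2 y z hyz ?_)
      intro u hu
      by_contra hneq
      obtain ⟨w, hw, hw'⟩ := h1 u y z hu hyz (lt_of_le_of_ne (hle u hu) hneq)
      exact absurd (hle w (hw.trans hu)) (not_le.mpr hw')
  have hmono : StrictMono ((τ.symm.trans σ).trans Fin.revPerm) := by
    intro i j hij
    simp only [Equiv.trans_apply, Fin.revPerm_apply, Fin.rev_lt_rev]
    rcases lt_trichotomy (σ (τ.symm j)) (σ (τ.symm i)) with h | h | h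
    · exact h
    · exact absurd (τ.symm.injective (σ.injective h)) hij.ne'
    · have := key _ _ _ rfl h
      simp only [Equiv.apply_symm_apply] at this
      exact absurd this hij.not_gt
  intro x
  let e : Fin n ≃o Fin n :=
    StrictMono.orderIsoOfSurjective _ hmono ((τ.symm.trans σ).trans Fin.revPerm).surjective
  have he : e = OrderIso.refl _ := Subsingleton.elim _ _
  have h3 : e (τ x) = τ x := by rw [he]; rfl
  have h4 : (σ x).rev = τ x := by
    have h5 : e (τ x) = (σ (τ.symm (τ x))).rev := rfl
    rw [Equiv.symm_apply_apply] at h5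
    rw [← h5, h3]
  rw [← h4, Fin.rev_rev]
end

section
/- Let A be a symmetric n×n real matrix, let τ be an SFS ordering of A, and let σ be an SFS_+ ordering of A with respect to τ. Assume that σ = τ^{-1} (the reverse of τ). Then A is Robinsonian if and only if σ is a Robinson ordering of A. -/
def RobZ {n : ℕ} (A : Matrix (Fin n) (Fin n) ℝ) (p : Fin n → ℤ) : Prop :=
  Function.Injective p ∧
  ∀ x y z : Fin n, p x < p y → p y < p z → A x z ≤ A x y ∧ A x z ≤ A y z

def SFSN {n : ℕ} (A : Matrix (Fin n) (Fin n) ℝ) (s : Fin n → ℕ) : Prop :=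
  ∀ x y z : Fin n, s x < s y → s y < s z → A x y < A x z →
    ∃ u : Fin n, s u < s x ∧ A u z < A u y

lemma RobZ.neg {n : ℕ} {A : Matrix (Fin n) (Fin n) ℝ} (hA : ∀ x y, A x y = A y x)
    {p : Fin n → ℤ} (h : RobZ A p) : RobZ A (fun x => - p x) := by
  refine ⟨fun a b hab => h.1 (by simpa using hab), fun x y z h1 h2 => ?_⟩
  have := h.2 z y x (by linarith) (by linarith)
  rw [hA x z, hA x y, hA y z]
  exact ⟨this.2, this.1⟩

lemma sfs_min {n : ℕ} {A : Matrix (Fin n) (Fin n) ℝ} {s : Fin n → ℕ} (hs : SFSN A s)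
    (x y z : Fin n) (h1 : s x < s y) (h2 : s y < s z) (h3 : A x y < A x z) :
    ∃ u, s u < s x ∧ A u z < A u y ∧ ∀ v, s v < s u → A v y = A v z := by
  obtain ⟨u, hu, hu'⟩ := hs x y z h1 h2 h3
  classical
  have hne : (Finset.univ.filter fun v => A v y ≠ A v z).Nonempty :=
    ⟨u, by simp [hu'.ne']⟩
  obtain ⟨m, hm, hmin⟩ := Finset.exists_min_image _ s hne
  simp only [Finset.mem_filter, Finset.mem_univ, true_and] at hm hmin
  have hmu := hmin u hu'.ne'
  have htie : ∀ v, s v < s m → A v y = A v z := by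
    intro v hv
    by_contra hc
    exact absurd (hmin v hc) (by omega)
  refine ⟨m, by omega, ?_, htie⟩
  rcases lt_or_gt_of_ne hm with h | h
  · obtain ⟨w, hw, hw'⟩ := hs m y z (by omega) h2 h
    exact absurd (htie w hw) hw'.ne'
  · exact h

lemma key {n : ℕ} {A : Matrix (Fin n) (Fin n) ℝ} (hA : ∀ x y, A x y = A y x)
    {s : Fin n → ℕ} (hs : SFSN A s) (k : ℕ) :
    ∀ p : Fin n → ℤ, RobZ A p → ∀ x, s x = k →
      (∀ y z, s x < s y → s y < s z → A x y < A x z → ¬ (p x < p z ∧ p z < p y)) ∧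
      (∀ q r z, s x < s q → s q < s r → s r < s z → A x q < A x r →
        (∀ v, s v < s x → A v r = A v z) →
        ¬ (p q < p z ∧ p z < p x ∧ p x < p r)) := by
  induction k using Nat.strong_induction_on with
  | _ k ih =>
  intro p hp x hx
  have tri : ∀ a b : Fin n, s a < s b → p a < p b ∨ p b < p a := by
    intro a b hab
    apply lt_or_gt_of_ne
    intro h
    rw [hp.1 h] at hab
    exact lt_irrefl _ hab
  have hcl : ∀ u y z, s u < k → s u < s y → s y < s z → A u y < A u z →
      ¬ (p u < p z ∧ p z < p y) ∧ ¬ (p y < p z ∧ p z < p u) := by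
    intro u y z hu h1 h2 h3
    refine ⟨(ih (s u) hu p hp u rfl).1 y z h1 h2 h3, fun h => ?_⟩
    exact (ih (s u) hu _ (hp.neg hA) u rfl).1 y z h1 h2 h3 ⟨by simp [h.2], by simp [h.1]⟩
  constructor
  · rintro y z h1 h2 h3 ⟨hxz, hzy⟩
    obtain ⟨u, hu, hu', htie⟩ := sfs_min hs x y z h1 h2 h3
    have hzu : p z < p u := by
      rcases tri u z (by omega) with h | h
      · have := (hp.2 u z y h hzy).1
        linarith
      · exact h
    have hux : A u x ≤ A u z := by
      have := (hp.2 x z u hxz hzu).2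
      rw [hA u x, hA u z]; exact this
    have hbad : A u x < A u y := lt_of_le_of_lt hux hu'
    have huy : p u < p y := by
      rcases tri u y (by omega) with h | h
      · exact h
      · exact absurd ⟨by omega, h⟩ (hcl u x y (by omega) hu h1 hbad).2
    exact (ih (s u) (by omega) p hp u rfl).2 x y z hu h1 h2 hbad htie ⟨hxz, hzu, huy⟩
  · rintro q r z h1 h2 h3 h4 htie ⟨hqz, hzx, hxr⟩
    obtain ⟨u, hu, hu', htie'⟩ := sfs_min hs x q r h1 h2 h4
    have e1 := htie u hu
    have huz : p u < p z := by
      rcases tri u z (by omega) with h | h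
      · exact h
      · have := (hp.2 q z u hqz h).2
        rw [hA q u, hA z u] at this
        linarith
    have e2 : A u x ≤ A u z := (hp.2 u z x huz hzx).1
    have hbad : A u x < A u q := by linarith
    have hqu : p q < p u := by
      rcases tri u q (by omega) with h | h
      · exact absurd ⟨h, by omega⟩ (hcl u x q (by omega) hu h1 hbad).1
      · exact h
    refine (ih (s u) (by omega) _ (hp.neg hA) u rfl).2 x q z hu h1 (by omega) hbad ?_
      ⟨by simpa using hzx, by simpa using huz, by simpa using hqu⟩
    intro v hv
    rw [htie' v hv, htie v (by omega)]

lemma key2 {n : ℕ} {A : Matrix (Fin n) (Fin n) ℝ} (hA : ∀ x y, A x y = A y x)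
    {s t : Fin n → ℕ} (hs : SFSN A s) (ht : SFSN A t)
    (hst : ∀ x y, s x < s y ↔ t y < t x) {p : Fin n → ℤ} (hp : RobZ A p)
    (x y z : Fin n) (h1 : s x < s y) (h2 : s y < s z) : A x z ≤ A x y := by
  by_contra! h
  have nxy : p x ≠ p y := fun e => by rw [hp.1 e] at h1; omega
  have nyz : p y ≠ p z := fun e => by rw [hp.1 e] at h2; omega
  have nxz : p x ≠ p z := fun e => by rw [hp.1 e] at h1; omega
  have a1 := (key hA hs _ p hp x rfl).1 y z h1 h2 h
  have a2 := (key hA hs _ _ (hp.neg hA) x rfl).1 y z h1 h2 h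
  have h' : A z y < A z x := by
    rcases lt_or_gt_of_ne nxy with h3 | h3 <;> rcases lt_or_gt_of_ne nyz with h4 | h4 <;>
      rcases lt_or_gt_of_ne nxz with h5 | h5 <;> try omega
    · have := (hp.2 x y z h3 h4).1; linarith
    · have := (hp.2 z x y h5 h3).1
      have := (hp.2 z x y h5 h3).2
      rw [hA z x]; linarith
    · have := (hp.2 y x z h3 h5).1
      rw [hA z x, hA z y]; rw [hA y x] at this; linarith
    · have := (hp.2 z y x h4 h3).2
      rw [hA z x, hA y x] at this; linarith
  have b1 := (key hA ht _ p hp z rfl).1 y x ((hst _ _).1 h2) ((hst _ _).1 h1) h'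
  have b2 := (key hA ht _ _ (hp.neg hA) z rfl).1 y x ((hst _ _).1 h2) ((hst _ _).1 h1) h'
  have c1 : ¬ (p x < p y ∧ p y < p z) := fun hh => by
    have := (hp.2 x y z hh.1 hh.2).1; linarith
  have c2 : ¬ (p z < p y ∧ p y < p x) := fun hh => by
    have := (hp.2 z y x hh.1 hh.2).2
    rw [hA z x, hA y x] at this; linarith
  simp only [neg_lt_neg_iff] at a2 b2
  omega

/-- If `τ` is an SFS ordering of the symmetric matrix `A`, `σ` is an SFS₊
ordering of `A` with respect to `τ`, and `σ = τ⁻¹` (the reverse of `τ`), then `A` is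
Robinsonian iff `σ` is a Robinson ordering of `A`. -/
theorem stmt_12 {n : ℕ} (A : Matrix (Fin n) (Fin n) ℝ) (hA : A.IsSymm)
    (τ : Equiv.Perm (Fin n)) (hτ : IsSFSOrdering A τ)
    (σ : Equiv.Perm (Fin n)) (hσ : IsSFSPlus A τ σ)
    (hrev : ∀ x : Fin n, σ x = (τ x).rev) :
    IsRobinsonian A ↔ IsRobinsonOrdering A σ := by
  have hS : ∀ x y, A x y = A y x := fun x y => hA.apply y x
  have hst : ∀ x y, (σ x).val < (σ y).val ↔ (τ y).val < (τ x).val := by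
    intro x y
    rw [hrev x, hrev y, ← Fin.lt_def, Fin.rev_lt_rev, Fin.lt_def]
  refine ⟨?_, fun h => ⟨σ, h⟩⟩
  rintro ⟨π, hπ⟩
  have hp : RobZ A (fun x => ((π x).val : ℤ)) := by
    refine ⟨fun a b hab => ?_, fun x y z h1 h2 => ?_⟩
    · apply π.injective
      apply Fin.ext
      simpa using hab
    · exact le_min_iff.1 (hπ x y z (by simpa using h1) (by simpa using h2))
  have hs : SFSN A (fun x => (σ x).val) := hσ.1
  have ht : SFSN A (fun x => (τ x).val) := hτ
  intro x y z h1 h2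
  refine le_min (key2 hS hs ht hst hp x y z h1 h2) ?_
  have := key2 hS ht hs (fun a b => (hst b a).symm) hp z y x ((hst _ _).1 h2) ((hst _ _).1 h1)
  rwa [hS z x, hS z y] at this
end

section
/- Let A be a symmetric n×n real matrix that is Robinsonian. A vertex z ∈ V is an anchor of A if and only if z is the last vertex of some SFS ordering of A. -/
theorem aux_rob {n : ℕ} {A : Matrix (Fin n) (Fin n) ℝ} (hs : ∀ a b, A a b = A b a)
    {π : Equiv.Perm (Fin n)} (hπ : IsRobinsonOrdering A π) (a b c : Fin n)
    (h : (π a < π b ∧ π b < π c) ∨ (π c < π b ∧ π b < π a)) :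
    A a c ≤ A a b ∧ A a c ≤ A b c := by
  rcases h with ⟨h1, h2⟩ | ⟨h1, h2⟩
  · exact le_min_iff.1 (hπ a b c h1 h2)
  · have := le_min_iff.1 (hπ c b a h1 h2)
    rw [hs a c, hs a b, hs b c]
    exact ⟨this.2, this.1⟩

theorem aux_D {n : ℕ} {A : Matrix (Fin n) (Fin n) ℝ}
    {σ : Equiv.Perm (Fin n)} (hσ : IsSFSOrdering A σ) (z : Fin n)
    (L : Fin n → Prop)
    (hO : ∀ e f, e ≠ z → f ≠ z → (L e ↔ ¬ L f) → A e f ≤ A e z)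
    (N : Fin n) (hN : N ≤ σ z)
    (hE : ∀ x y, σ x < σ y → σ y < N → (L x ↔ ¬ L y) → A x z ≤ A x y) :
    ∀ (k : ℕ) (a b c : Fin n), (σ a).val = k → σ a < σ b → σ b < σ c → σ c < N →
      (L a ↔ L c) → (L a ↔ ¬ L b) → A a c ≤ A a z := by
  intro k
  induction k using Nat.strong_induction_on with
  | _ k ih =>
  intro a b c hk hab hbc hc hac hab'
  by_contra hcon
  push Not at hcon
  have nz : ∀ w, σ w < N → w ≠ z := by
    rintro w hw rfl
    exact absurd hw (not_lt.2 hN)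
  have h1 : A a b ≤ A a z := hO a b (nz _ (by omega)) (nz _ (by omega)) hab'
  obtain ⟨d, hd, hdc⟩ := hσ a b c hab hbc (by linarith)
  by_cases hL : L d ↔ L b
  · have h2 : A d z ≤ A d c := hE d c (by omega) hc (by tauto)
    have := ih (σ d) (by omega) d a b rfl hd hab (by omega) hL (by tauto)
    linarith
  · have h2 : A d b ≤ A d z := hO d b (nz _ (by omega)) (nz _ (by omega)) (by tauto)
    obtain ⟨e, he, hec⟩ := hσ d c z (by omega) (by omega) (by linarith)
    by_cases hL' : L e ↔ L c
    · have := ih (σ e) (by omega) e b c rfl (by omega) hbc hc hL' (by tauto)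
      linarith
    · have := hO e c (nz _ (by omega)) (nz _ (by omega)) (by tauto)
      linarith

theorem aux_E {n : ℕ} {A : Matrix (Fin n) (Fin n) ℝ}
    {σ : Equiv.Perm (Fin n)} (hσ : IsSFSOrdering A σ) (z : Fin n)
    (L : Fin n → Prop)
    (hO : ∀ e f, e ≠ z → f ≠ z → (L e ↔ ¬ L f) → A e f ≤ A e z) :
    ∀ (k : ℕ) (x y : Fin n), (σ y).val = k → σ x < σ y → σ y < σ z →
      (L x ↔ ¬ L y) → A x z ≤ A x y := by
  intro k
  induction k using Nat.strong_induction_on with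
  | _ k ih =>
  intro x y hk hxy hyz hL
  by_contra hcon
  push Not at hcon
  have nz : ∀ w, σ w < σ z → w ≠ z := by
    rintro w hw rfl
    exact absurd hw (lt_irrefl _)
  have hD := aux_D hσ z L hO (σ y) hyz.le
    (fun a b hab hb hL => ih (σ b) (by omega) a b rfl hab (by omega) hL)
  have hex : ∃ m : ℕ, ∃ u, (σ u).val = m ∧ σ u < σ x ∧ A u z < A u y := by
    obtain ⟨u, hu, hu'⟩ := hσ x y z hxy hyz hcon
    exact ⟨_, u, rfl, hu, hu'⟩
  classical
  obtain ⟨u, hum, hux, huA⟩ := Nat.find_spec hex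
  have hmin : ∀ u', σ u' < σ u → ¬ A u' z < A u' y := by
    intro u' hu' hA'
    exact Nat.find_min hex (m := (σ u').val) (by omega) ⟨u', rfl, by omega, hA'⟩
  have hLu : L u ↔ L y := by
    by_contra h
    have := hO u y (nz _ (by omega)) (nz _ (by omega)) (by tauto)
    linarith
  have h1 := hO u x (nz _ (by omega)) (nz _ (by omega)) (by tauto)
  obtain ⟨d, hd, hdA⟩ := hσ u x y hux hxy (by linarith)
  have h2 : A d z ≤ A d y := by
    by_contra h
    push Not at h
    obtain ⟨e, he, heA⟩ := hσ d y z (by omega) hyz h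
    exact hmin e (by omega) heA
  have hLd : L d ↔ L x := by
    by_contra h
    have := hO d x (nz _ (by omega)) (nz _ (by omega)) (by tauto)
    linarith
  have := hD (σ d) d u x rfl hd hux hxy hLd (by tauto)
  linarith

/-- an edge from `p` to `q` avoiding `v` -/
def Ed {n : ℕ} (A : Matrix (Fin n) (Fin n) ℝ) (v p q : Fin n) : Prop :=
  p ≠ v ∧ q ≠ v ∧ min (A v p) (A v q) < A p q

theorem Ed.symm' {n : ℕ} {A : Matrix (Fin n) (Fin n) ℝ} (hs : ∀ a b, A a b = A b a)
    {v p q : Fin n} (h : Ed A v p q) : Ed A v q p :=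
  ⟨h.2.1, h.1, by rw [min_comm, hs q p]; exact h.2.2⟩

theorem Ed.side {n : ℕ} {A : Matrix (Fin n) (Fin n) ℝ} (hs : ∀ a b, A a b = A b a)
    {π : Equiv.Perm (Fin n)} (hπ : IsRobinsonOrdering A π)
    {v p q : Fin n} (h : Ed A v p q) : π p < π v ↔ π q < π v := by
  have key : ∀ p q, Ed A v p q → π p < π v → π q < π v := by
    intro p q h hp
    by_contra hq
    have hne : π q ≠ π v := fun e => h.2.1 (π.injective e)
    have := aux_rob hs hπ p v q (Or.inl ⟨hp, by omega⟩)
    have h3 := h.2.2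
    rw [hs v p] at h3
    exact absurd h3 (not_lt.2 (le_min this.1 this.2))
  exact ⟨key p q h, key q p (h.symm' hs)⟩

def Prec {n : ℕ} (A : Matrix (Fin n) (Fin n) ℝ) (z u v : Fin n) : Prop :=
  u ≠ v ∧ v ≠ z ∧ Relation.ReflTransGen (Ed A v) u z

theorem prec_side {n : ℕ} {A : Matrix (Fin n) (Fin n) ℝ} (hs : ∀ a b, A a b = A b a)
    {π : Equiv.Perm (Fin n)} (hπ : IsRobinsonOrdering A π) {z u v : Fin n}
    (h : Prec A z u v) : π u < π v ↔ π z < π v := by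
  obtain ⟨-, -, h⟩ := h
  induction h using Relation.ReflTransGen.head_induction_on with
  | refl => rfl
  | head h _ ih => exact (h.side hs hπ).trans ih

theorem prec_neg {n : ℕ} {A : Matrix (Fin n) (Fin n) ℝ} (hs : ∀ a b, A a b = A b a)
    {z u v : Fin n} (h : Prec A z u v) (w : Fin n) : Prec A z w v ∨ Prec A z u w := by
  by_cases hwv : w = v
  · subst hwv; exact Or.inr h
  by_cases hwu : w = u
  · subst hwu; exact Or.inl h
  obtain ⟨h1, h2, h3⟩ := h
  by_cases hwz : w = z
  · subst hwz; exact Or.inl ⟨hwv, h2, .refl⟩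
  by_contra hcon
  push Not at hcon
  obtain ⟨hc1, hc2⟩ := hcon
  have hn : ¬ Relation.ReflTransGen (Ed A v) w z := fun h => hc1 ⟨hwv, h2, h⟩
  apply hc2
  refine ⟨fun e => hwu e.symm, hwz, ?_⟩
  clear h1 hwu hc2 hc1
  induction h3 using Relation.ReflTransGen.head_induction_on with
  | refl => exact .refl
  | @head p q h hq ih =>
    have hp := Relation.ReflTransGen.head h hq
    refine .head ⟨?_, ?_, ?_⟩ ih
    · rintro rfl; exact hn hp
    · rintro rfl; exact hn hq
    · by_contra hlt
      push Not at hlt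
      obtain ⟨l1, l2⟩ := le_min_iff.1 hlt
      rcases min_lt_iff.1 h.2.2 with h4 | h4
      · exact hn (.head ⟨hwv, h.1, min_lt_iff.2 (Or.inr (by linarith))⟩ hp)
      · exact hn (.head ⟨hwv, h.2.1, min_lt_iff.2 (Or.inr (by linarith))⟩ hq)

theorem sfs_closed {n : ℕ} {A : Matrix (Fin n) (Fin n) ℝ} (hs : ∀ a b, A a b = A b a)
    {π : Equiv.Perm (Fin n)} (hπ : IsRobinsonOrdering A π)
    {σ : Equiv.Perm (Fin n)} (hσ : IsSFSOrdering A σ) {z : Fin n} (hz : IsLastOf σ z)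
    {x y t : Fin n} (hxy : σ x < σ y) (hyz : y ≠ z)
    (hL : π x < π z ↔ ¬ π y < π z) (he : Ed A y x t) :
    t ≠ z ∧ σ t < σ y ∧ (π t < π z ↔ ¬ π y < π z) := by
  have last : ∀ w, w ≠ z → σ w < σ z := fun w hw =>
    lt_of_le_of_ne (hz w) (fun e => hw (σ.injective e))
  have pne : ∀ a b, a ≠ b → π a ≠ π b := fun a b hab e => hab (π.injective e)
  have hyz' := last y hyz
  have hO2 : ∀ e f, e ≠ z → f ≠ z → (π e < π z ↔ ¬ π f < π z) →
      A e f ≤ A e z ∧ A e f ≤ A z f := by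
    intro e f he hf h
    have := pne e z he
    have := pne f z hf
    apply aux_rob hs hπ e z f
    omega
  have hO : ∀ e f, e ≠ z → f ≠ z → (π e < π z ↔ ¬ π f < π z) → A e f ≤ A e z :=
    fun e f he hf h => (hO2 e f he hf h).1
  have hE := fun x y => aux_E hσ z (fun a => π a < π z) hO (σ y) x y rfl
  have hD := fun a b c => aux_D hσ z (fun a => π a < π z) hO (σ z) le_rfl hE (σ a) a b c rfl
  have hxz : x ≠ z := by rintro rfl; omega
  have e1 := hE x y hxy hyz' hL
  have e2 := hO2 x y hxz hyz hL
  have hlt := he.2.2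
  rw [hs y x] at hlt
  have htz : t ≠ z := by
    rintro rfl
    rcases min_lt_iff.1 hlt with h | h
    · linarith
    · rw [hs y t] at h; linarith
  have hside := he.side hs hπ
  have hty : t ≠ y := he.2.1
  have nt := pne t z htz
  have nx := pne x z hxz
  have ny := pne y z hyz
  have nty := pne t y hty
  have hLt : π t < π z ↔ ¬ π y < π z := by
    by_contra hc
    have h1 := hO x t hxz htz (by omega)
    have h2 := (aux_rob hs hπ x t y (by omega)).2
    rw [hs y t] at hlt
    rcases min_lt_iff.1 hlt with h | h <;> linarith
  refine ⟨htz, ?_, hLt⟩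
  by_contra hc
  have hyt : σ y < σ t := by
    have : σ t ≠ σ y := fun e => hty (σ.injective e)
    omega
  have h1 := hE y t hyt (last t htz) (by tauto)
  have h2 := hD x y t hxy hyt (last t htz) (by tauto) hL
  rw [hs z y] at e2
  rcases min_lt_iff.1 hlt with h | h <;> linarith

theorem prec_asymm {n : ℕ} {A : Matrix (Fin n) (Fin n) ℝ} (hs : ∀ a b, A a b = A b a)
    {π : Equiv.Perm (Fin n)} (hπ : IsRobinsonOrdering A π)
    {σ : Equiv.Perm (Fin n)} (hσ : IsSFSOrdering A σ) {z : Fin n} (hz : IsLastOf σ z)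
    {u v : Fin n} (h1 : Prec A z u v) (h2 : Prec A z v u) : False := by
  wlog huv : σ u < σ v generalizing u v
  · refine this h2 h1 ?_
    have : σ u ≠ σ v := fun e => h1.1 (σ.injective e)
    omega
  have s1 := prec_side hs hπ h1
  have s2 := prec_side hs hπ h2
  have n1 : π u ≠ π v := fun e => h1.1 (π.injective e)
  have n2 : π v ≠ π z := fun e => h1.2.1 (π.injective e)
  have n3 : π u ≠ π z := fun e => h2.2.1 (π.injective e)
  have key : ∀ p, Relation.ReflTransGen (Ed A v) u p →
      p ≠ z ∧ σ p < σ v ∧ (π p < π z ↔ ¬ π v < π z) := by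
    intro p hp
    induction hp with
    | refl => exact ⟨h2.2.1, huv, by omega⟩
    | tail _ he ih => exact sfs_closed hs hπ hσ hz ih.2.1 h1.2.1 ih.2.2 he
  exact (key z h1.2.2).1 rfl

theorem perm_of_key {n : ℕ} {β : Type} [LinearOrder β] (f : Fin n → β)
    (hf : Function.Injective f) :
    ∃ τ : Equiv.Perm (Fin n), ∀ a b, τ a < τ b ↔ f a < f b := by
  classical
  have hlt : ∀ a, (Finset.univ.filter (fun b => f b < f a)).card < n := by
    intro a
    have : (Finset.univ.filter (fun b => f b < f a)) ⊂ Finset.univ := by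
      refine Finset.filter_ssubset.2 ⟨a, Finset.mem_univ _, lt_irrefl _⟩
    simpa using Finset.card_lt_card this
  let g : Fin n → Fin n := fun a => ⟨_, hlt a⟩
  have mono : ∀ a b, f a < f b → g a < g b := by
    intro a b hab
    change (Finset.univ.filter (fun c => f c < f a)).card <
      (Finset.univ.filter (fun c => f c < f b)).card
    apply Finset.card_lt_card
    refine Finset.ssubset_iff_of_subset ?_ |>.2 ⟨a, by simpa using hab, by simp⟩
    intro c hc
    simp only [Finset.mem_filter, Finset.mem_univ, true_and] at hc ⊢
    exact hc.trans hab
  have inj : Function.Injective g := by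
    intro a b hab
    rcases lt_trichotomy (f a) (f b) with h | h | h
    · exact absurd hab (mono _ _ h).ne
    · exact hf h
    · exact absurd hab (mono _ _ h).ne'
  refine ⟨Equiv.ofBijective g (Finite.injective_iff_bijective.1 inj), fun a b => ?_⟩
  simp only [Equiv.ofBijective_apply]
  refine ⟨fun h => ?_, mono a b⟩
  rcases lt_trichotomy (f a) (f b) with h' | h' | h'
  · exact h'
  · rw [hf h'] at h; exact absurd h (lt_irrefl _)
  · exact absurd h (mono _ _ h').not_gt

theorem valid_anchor {n : ℕ} {A : Matrix (Fin n) (Fin n) ℝ} (hs : ∀ a b, A a b = A b a)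
    {π : Equiv.Perm (Fin n)} (hπ : IsRobinsonOrdering A π) (z : Fin n)
    (hasymm : ∀ u v, Prec A z u v → Prec A z v u → False) : IsAnchor A z := by
  classical
  let rank : Fin n → ℕ := fun a => (Finset.univ.filter (fun w => Prec A z a w)).card
  have r1 : ∀ a b, Prec A z a b → rank b < rank a := by
    intro a b hab
    apply Finset.card_lt_card
    refine Finset.ssubset_iff_of_subset ?_ |>.2
      ⟨b, by simpa using hab, by simpa using fun h => hasymm b b h h⟩
    intro w hw
    simp only [Finset.mem_filter, Finset.mem_univ, true_and] at hw ⊢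
    rcases prec_neg hs hab w with h | h
    · exact (hasymm _ _ h hw).elim
    · exact h
  have r2 : ∀ a b, ¬ Prec A z a b → rank a ≤ rank b := by
    intro a b hab
    apply Finset.card_le_card
    intro w hw
    simp only [Finset.mem_filter, Finset.mem_univ, true_and] at hw ⊢
    rcases prec_neg hs hw b with h | h
    · exact h
    · exact (hab h).elim
  have r : ∀ a b, Prec A z a b ↔ rank b < rank a := fun a b =>
    ⟨r1 a b, fun h => by by_contra hc; have := r2 a b hc; omega⟩
  -- extending by an edge
  have ext : ∀ a c b, Prec A z a b → c ≠ b → min (A b a) (A b c) < A a c → Prec A z c b := by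
    intro a c b hab hcb h
    exact ⟨hcb, hab.2.1, .head (Ed.symm' hs ⟨hab.1, hcb, h⟩) hab.2.2⟩
  have sameside : ∀ a b w, rank a = rank b → Prec A z a w → (π a < π w ↔ π b < π w) := by
    intro a b w hab ha
    have hb : Prec A z b w := by rw [r] at ha ⊢; omega
    exact (prec_side hs hπ ha).trans (prec_side hs hπ hb).symm
  let flip : ℕ → Prop := fun k => ∃ p q w, rank p = k ∧ rank q = k ∧ Prec A z p w ∧
    π p < π q ∧ π q < π w ∧ A p w < A q w
  let pos : Fin n → ℤ := fun a => if flip (rank a) then -((π a).val : ℤ) else (π a).val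
  let f : Fin n → ℕ ×ₗ ℤ := fun a => toLex (rank a, pos a)
  have hf : Function.Injective f := by
    intro a b hab
    have h := toLex.injective hab
    have h1 : rank a = rank b := congrArg Prod.fst h
    have h2 : pos a = pos b := congrArg Prod.snd h
    apply π.injective
    apply Fin.ext
    simp only [pos, h1] at h2
    split_ifs at h2 <;> omega
  have flt : ∀ a b, f a < f b → rank a < rank b ∨ (rank a = rank b ∧
      ((flip (rank b) ∧ π b < π a) ∨ (¬ flip (rank b) ∧ π a < π b))) := by
    intro a b hab
    rcases Prod.Lex.toLex_lt_toLex.1 hab with h | ⟨h, h'⟩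
    · exact Or.inl h
    · right
      change rank a = rank b at h
      change pos a < pos b at h'
      refine ⟨h, ?_⟩
      simp only [pos, h] at h'
      split_ifs at h' with hfl
      · exact Or.inl ⟨hfl, by omega⟩
      · exact Or.inr ⟨hfl, by omega⟩
  obtain ⟨τ, hτ⟩ := perm_of_key f hf
  have ne_of_prec : ∀ a b, Prec A z a b → π a ≠ π b := fun a b h e => h.1 (π.injective e)
  refine ⟨τ, ?_, ?_⟩
  · intro x y c hxy hyc
    have nxy : x ≠ y := by rintro rfl; exact lt_irrefl _ hxy
    rw [hτ] at hxy hyc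
    have kxy := flt _ _ hxy
    rcases flt _ _ hyc with h | ⟨h, h'⟩
    · -- c strictly closer than y
      have hcy := (r c y).2 h
      by_contra hcon
      push Not at hcon
      have := ext c x y hcy nxy (by
        rw [hs c x, hs y x, min_comm]; exact hcon)
      have := (r x y).1 this
      omega
    · rcases kxy with g | ⟨g, g'⟩
      · have hyx := (r y x).2 g
        have hcx := (r c x).2 (by omega)
        have ss := sameside y c x h hyx
        have ny := ne_of_prec _ _ hyx
        have nc := ne_of_prec _ _ hcx
        rcases h' with ⟨fl, hp⟩ | ⟨fl, hp⟩
        · by_cases hx : π y < π x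
          · exact le_min_iff.2 (aux_rob hs hπ x y c (by omega))
          · have hm : A x c ≤ A x y := by
              by_contra hm
              push Not at hm
              obtain ⟨p, q, w, rp, rq, hpw, hpq, hqw, hA⟩ := fl
              have hpx := (r p x).2 (by omega)
              have hqx := (r q x).2 (by omega)
              have npx := ne_of_prec _ _ hpx
              have s1 := sameside p c x (by omega) hpx
              have s2 := sameside p q x (by omega) hpx
              have s3 := sameside p c w (by omega) hpw
              have s4 := sameside p y w (by omega) hpw
              have hpw' := (r p w).1 hpw
              -- extreme elements of the class
              obtain ⟨e1, re1, h1c, h1p, k1, k2⟩ : ∃ e1, rank e1 = rank c ∧ π e1 ≤ π c ∧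
                  π e1 ≤ π p ∧ A x c ≤ A x e1 ∧ A e1 w ≤ A p w := by
                rcases lt_trichotomy (π c) (π p) with hh | hh | hh
                · exact ⟨c, rfl, le_rfl, hh.le, le_rfl,
                    (aux_rob hs hπ c p w (by omega)).2⟩
                · have := π.injective hh
                  subst this
                  exact ⟨c, rfl, le_rfl, le_rfl, le_rfl, le_rfl⟩
                · exact ⟨p, by omega, hh.le, le_rfl,
                    (aux_rob hs hπ x p c (by omega)).1, le_rfl⟩
              obtain ⟨e2, re2, h2y, h2q, k3, k4⟩ : ∃ e2, rank e2 = rank c ∧ π y ≤ π e2 ∧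
                  π q ≤ π e2 ∧ A x e2 ≤ A x y ∧ A q w ≤ A e2 w := by
                rcases lt_trichotomy (π y) (π q) with hh | hh | hh
                · exact ⟨q, by omega, hh.le, le_rfl,
                    (aux_rob hs hπ x y q (by omega)).1, le_rfl⟩
                · have := π.injective hh
                  subst this
                  exact ⟨y, by omega, le_rfl, le_rfl, le_rfl, le_rfl⟩
                · exact ⟨y, by omega, le_rfl, hh.le, le_rfl,
                    (aux_rob hs hπ q y w (by omega)).2⟩
              have he1x := (r e1 x).2 (by omega)
              have he2x := (r e2 x).2 (by omega)
              have he1w := (r e1 w).2 (by omega)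
              have t1 := sameside p e1 x (by omega) hpx
              have t2 := sameside p e2 w (by omega) hpw
              have ne1 := ne_of_prec _ _ he1x
              have b1 := aux_rob hs hπ x e1 w (by omega)
              have b2 := aux_rob hs hπ x e2 w (by omega)
              have nxw : x ≠ w := by rintro rfl; omega
              refine hasymm w x (ext e2 w x he2x nxw.symm (min_lt_iff.2 (Or.inr ?_)))
                (ext e1 x w he1w nxw (min_lt_iff.2 (Or.inr ?_)))
              · linarith
              · rw [hs w x, hs e1 x]; linarith
            have hb := (aux_rob hs hπ x c y (by omega)).2
            rw [hs c y] at hb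
            exact le_min hm (hm.trans hb)
        · by_cases hx : π y < π x
          · have hm : A x c ≤ A x y := by
              by_contra hm
              push Not at hm
              exact fl ⟨y, c, x, h, rfl, hyx, hp, by omega, by rw [hs y x, hs c x]; exact hm⟩
            have hb := (aux_rob hs hπ x c y (by omega)).2
            rw [hs c y] at hb
            exact le_min hm (hm.trans hb)
          · exact le_min_iff.2 (aux_rob hs hπ x y c (by omega))
      · rw [h] at g'
        apply le_min_iff.2 (aux_rob hs hπ x y c _)
        rcases g' with ⟨a1, a2⟩ | ⟨a1, a2⟩ <;> rcases h' with ⟨b1, b2⟩ | ⟨b1, b2⟩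
        · exact Or.inr ⟨b2, a2⟩
        · exact absurd a1 b1
        · exact absurd b1 a1
        · exact Or.inl ⟨a2, b2⟩
  · intro y
    by_cases hy : y = z
    · rw [hy]
    · apply le_of_lt
      rw [hτ]
      have : Prec A z z y := ⟨fun e => hy e.symm, hy, .refl⟩
      exact Prod.Lex.toLex_lt_toLex.2 (Or.inl (r1 _ _ this))

/-- For a symmetric Robinsonian matrix `A`, a vertex `z` is an anchor of
`A` iff it is the last vertex of some SFS ordering of `A`. -/
theorem stmt_13 {n : ℕ} (A : Matrix (Fin n) (Fin n) ℝ) (hA : A.IsSymm)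
    (hRob : IsRobinsonian A) (z : Fin n) :
    IsAnchor A z ↔ ∃ σ : Equiv.Perm (Fin n), IsSFSOrdering A σ ∧ IsLastOf σ z := by
  constructor
  · rintro ⟨π, h1, h2⟩
    refine ⟨π, ?_, h2⟩
    intro x y t hxy hyt hlt
    have := (le_min_iff.1 (h1 x y t hxy hyt)).1
    exact absurd hlt (not_lt.2 this)
  · rintro ⟨σ, h1, h2⟩
    obtain ⟨π, hπ⟩ := hRob
    have hs : ∀ a b, A a b = A b a := fun a b => hA.apply b a
    exact valid_anchor hs hπ z (fun u v => prec_asymm hs hπ h1 h2)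
end

section
/- Let A be a symmetric n×n real matrix that is Robinsonian, let a be an anchor of A, let σ be a good SFS ordering of A starting at a, and let π be a Robinson ordering of A starting at a. Then the similarity layers (L_0 = {a}, L_1, ..., L_r) of A rooted at a are compatible with both π and σ: for all i < j, every element of L_i precedes every element of L_j in π, and every element of L_i precedes every element of L_j in σ. -/
theorem layer_mem_union {n : ℕ} (A : Matrix (Fin n) (Fin n) ℝ) (a : Fin n) (i : ℕ) (x : Fin n)
    (hx : x ∈ simLayer A a i) : x ∈ simLayerUnion A a i := by
  cases i with
  | zero => exact hx
  | succ k => exact Or.inr hx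

theorem union_mono {n : ℕ} (A : Matrix (Fin n) (Fin n) ℝ) (a : Fin n) :
    Monotone (simLayerUnion A a) :=
  monotone_nat_of_le_succ fun _ _ hx => Or.inl hx

theorem union_initial {n : ℕ} (A : Matrix (Fin n) (Fin n) ℝ) (a : Fin n)
    (ρ : Equiv.Perm (Fin n)) (hfirst : IsFirstOf ρ a)
    (step : ∀ U : Set (Fin n), (∀ x ∈ U, ∀ z ∉ U, ρ x < ρ z) →
      ∀ x z u : Fin n, x ∉ U → z ∉ U → u ∈ U → (∀ v ∈ U, A v z ≤ A v x) → A u z < A u x →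
        ρ z < ρ x → False) (i : ℕ) :
    ∀ x ∈ simLayerUnion A a i, ∀ z ∉ simLayerUnion A a i, ρ x < ρ z := by
  induction i with
  | zero =>
    intro x hx z hz
    have hx' : x = a := hx
    subst hx'
    refine lt_of_le_of_ne (hfirst z) fun h => hz ?_
    exact (ρ.injective h).symm
  | succ i ih =>
    intro x hx z hz
    have hzU : z ∉ simLayerUnion A a i := fun h => hz (Or.inl h)
    rcases hx with hx | ⟨hxU, hx⟩
    · exact ih x hx z hzU
    · have hz2 : ¬ ∀ u ∈ simLayerUnion A a i, ∀ w ∉ simLayerUnion A a i, A u w ≤ A u z :=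
        fun h => hz (Or.inr ⟨hzU, h⟩)
      push Not at hz2
      obtain ⟨u, hu, w, hw, hlt⟩ := hz2
      by_contra hcon
      rcases lt_or_eq_of_le (not_lt.mp hcon) with h | h
      · exact step _ ih x z u hxU hzU hu (fun v hv => hx v hv z hzU)
          (lt_of_lt_of_le hlt (hx u hu w hw)) h
      · have := ρ.injective h
        subst this
        exact hz (Or.inr ⟨hxU, hx⟩)

/-- The similarity layers of a symmetric Robinsonian matrix `A` rooted at
an anchor `a` are compatible with every Robinson ordering starting at `a` and with every
good SFS ordering starting at `a`. -/
theorem stmt_15 {n : ℕ} (A : Matrix (Fin n) (Fin n) ℝ) (hA : A.IsSymm)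
    (hRob : IsRobinsonian A) (a : Fin n) (ha : IsAnchor A a)
    (σ : Equiv.Perm (Fin n)) (hσ : IsGoodSFS A σ) (hσa : IsFirstOf σ a)
    (π : Equiv.Perm (Fin n)) (hπ : IsRobinsonOrdering A π) (hπa : IsFirstOf π a) :
    ∀ (i j : ℕ), i < j → ∀ x ∈ simLayer A a i, ∀ y ∈ simLayer A a j,
      π x < π y ∧ σ x < σ y := by
  intro i j hij x hx y hy
  obtain ⟨k, rfl⟩ : ∃ k, j = k + 1 := ⟨j - 1, by omega⟩
  have hxk : x ∈ simLayerUnion A a k :=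
    union_mono A a (by omega : i ≤ k) (layer_mem_union A a i x hx)
  have hyk : y ∉ simLayerUnion A a k := hy.1
  constructor
  · refine union_initial A a π hπa ?_ k x hxk y hyk
    intro U hU x z u hx hz hu _ hlt h
    exact absurd ((hπ u z x (hU u hu z hz) h).trans (min_le_left _ _)) (not_le.mpr hlt)
  · refine union_initial A a σ hσa ?_ k x hxk y hyk
    intro U hU x z u hx hz hu hall hlt h
    obtain ⟨v, hv, hvlt⟩ := hσ.1 u z x (hU u hu z hz) h hlt
    have hvU : v ∈ U := by
      by_contra hn
      exact lt_asymm hv (hU u hu v hn)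
    exact absurd (hall v hvU) (not_le.mpr hvlt)
end
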